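/- arXiv:2603.16168 — 3 statements merged into one kernel-verified Lean document; each statement's English description precedes it below -/
import Mathlib

section
/- Let (t, x(·)), (t_k, x_k(·)) ∈ [0,T] × C for k ∈ ℕ and nonnegative functions c(·), c_k(·) ∈ L¹([0,T],ℝ) for k ∈ ℕ be such that |t_k − t| + ‖x_k(·) − x(·)‖_∞ + ‖c_k(·) − c(·)‖₁ → 0 as k → ∞. Then, for every sequence y_k(·) ∈ Y(t_k, x_k(·); c_k(·)), k ∈ ℕ, there exist a subsequence y_{k_i}(·), i ∈ ℕ, and a function y(·) ∈ Y(t, x(·); c(·)) such that ‖y_{k_i}(·) − y(·)‖_∞ → 0 as i → ∞. -/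
open MeasureTheory Set Filter Topology

noncomputable section

attribute [local instance] Classical.propDecidable

/-- Euclidean space `ℝⁿ`. -/
abbrev Euc (n : ℕ) : Type := EuclideanSpace ℝ (Fin n)

/-- The path space `C([-h,T], ℝⁿ)` with the sup norm. -/
abbrev PathSp (n : ℕ) (h T : ℝ) : Type := ContinuousMap (Set.Icc (-h) T) (Euc n)

/-- The time map `τ ↦ τ ∧ t` on `[-h,T]` (for `t ∈ [0,T]`, `h ≥ 0`, this is `min τ t`). -/
def stopTime (h T t : ℝ) (τ : Set.Icc (-h) T) : Set.Icc (-h) T :=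
  ⟨max (-h) (min τ.1 t), le_max_left _ _,
    max_le (le_trans τ.2.1 τ.2.2) (le_trans (min_le_left _ _) τ.2.2)⟩

lemma continuous_stopTime (h T t : ℝ) : Continuous (stopTime h T t) :=
  Continuous.subtype_mk
    (continuous_const.max (continuous_subtype_val.min continuous_const)) _

/-- The stopped path `x(· ∧ t)`. -/
def stopPath {n : ℕ} {h T : ℝ} (t : ℝ) (x : PathSp n h T) : PathSp n h T :=
  x.comp ⟨stopTime h T t, continuous_stopTime h T t⟩

/-- Evaluation of a path at a real time (times outside `[-h,T]` are projected). -/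
def evalP {n : ℕ} {h T : ℝ} (x : PathSp n h T) (τ : ℝ) : Euc n :=
  if hc : -h ≤ T then x (Set.projIcc (-h) T hc τ) else 0

/-- The `L¹([0,T])` distance between two functions. -/
def L1dist (T : ℝ) (c₁ c₂ : ℝ → ℝ) : ℝ := ∫ τ in Set.Icc (0:ℝ) T, |c₁ τ - c₂ τ|

/-- A nonnegative function in `L¹([0,T],ℝ)`. -/
def IntegNonneg (T : ℝ) (c : ℝ → ℝ) : Prop :=
  IntegrableOn c (Set.Icc 0 T) volume ∧ ∀ τ ∈ Set.Icc (0:ℝ) T, 0 ≤ c τ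

/-- `AC(t,x(·))`, presented with an explicit derivative witness: pairs `(y, y')`
such that `y(·∧t) = x(·∧t)`, `y'` is integrable on `[t,T]`, and `y` is the
indefinite integral of `y'` on `[t,T]` (i.e. `y|_{[t,T]}` is absolutely continuous
with a.e. derivative `y'`). -/
def ACPair {n : ℕ} {h T : ℝ} (t : ℝ) (x : PathSp n h T) :
    Set (PathSp n h T × (ℝ → Euc n)) :=
  {p | stopPath t p.1 = stopPath t x ∧ IntervalIntegrable p.2 volume t T ∧
       ∀ τ ∈ Set.Icc t T, evalP p.1 τ = evalP p.1 t + ∫ ξ in t..τ, p.2 ξ}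

/-- The set `AC(t,x(·))`. -/
def ACSet {n : ℕ} {h T : ℝ} (t : ℝ) (x : PathSp n h T) : Set (PathSp n h T) :=
  {y | ∃ y', (y, y') ∈ ACPair t x}

/-- Pairs `(y, y')` with `y ∈ Y(t,x(·);c(·))` and derivative witness `y'`. -/
def YPair {n : ℕ} {h T : ℝ} (t : ℝ) (x : PathSp n h T) (c : ℝ → ℝ) :
    Set (PathSp n h T × (ℝ → Euc n)) :=
  {p | p ∈ ACPair t x ∧
       ∀ᵐ τ ∂(volume.restrict (Set.Icc t T)), ‖p.2 τ‖ ≤ c τ * (1 + ‖stopPath τ p.1‖)}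

/-- The set `Y(t,x(·);c(·))`. -/
def YSet {n : ℕ} {h T : ℝ} (t : ℝ) (x : PathSp n h T) (c : ℝ → ℝ) :
    Set (PathSp n h T) :=
  {y | ∃ y', (y, y') ∈ YPair t x c}

/-- Condition (A.1): measurability in `t` on `[0,T]`. -/
def CondA1 {n : ℕ} {h T : ℝ} (H : ℝ → PathSp n h T → Euc n → ℝ) : Prop :=
  ∀ (x : PathSp n h T) (s : Euc n),
    Measurable ((Set.Icc (0:ℝ) T).restrict (fun t => H t x s))

/-- Condition (A.2): continuity in `(x,s)` for a.e. `t`. -/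
def CondA2 {n : ℕ} {h T : ℝ} (H : ℝ → PathSp n h T → Euc n → ℝ) : Prop :=
  ∃ E : Set ℝ, E ⊆ Set.Icc 0 T ∧ volume E = ENNReal.ofReal T ∧
    ∀ t ∈ E, Continuous (fun p : PathSp n h T × Euc n => H t p.1 p.2)

/-- Condition (A.3) for a given compact set `D` and function `λ_H(·;D)`. -/
def CondA3For {n : ℕ} {h T : ℝ} (H : ℝ → PathSp n h T → Euc n → ℝ)
    (D : Set (PathSp n h T)) (lam : ℝ → ℝ) : Prop :=
  IntegNonneg T lam ∧
  ∀ x₁ ∈ D, ∀ x₂ ∈ D, ∀ s : Euc n,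
    ∃ E : Set ℝ, E ⊆ Set.Icc 0 T ∧ volume E = ENNReal.ofReal T ∧
      ∀ t ∈ E, |H t x₁ s - H t x₂ s| ≤
        lam t * (1 + ‖s‖) * ‖stopPath t x₁ - stopPath t x₂‖

/-- Condition (A.3). -/
def CondA3 {n : ℕ} {h T : ℝ} (H : ℝ → PathSp n h T → Euc n → ℝ) : Prop :=
  ∀ D : Set (PathSp n h T), IsCompact D → ∃ lam : ℝ → ℝ, CondA3For H D lam

/-- Condition (A.4), with the function `c_H(·)` made explicit. -/
def CondA4 {n : ℕ} {h T : ℝ} (H : ℝ → PathSp n h T → Euc n → ℝ) (cH : ℝ → ℝ) : Prop :=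
  IntegNonneg T cH ∧
  ∃ E : Set ℝ, E ⊆ Set.Icc 0 T ∧ volume E = ENNReal.ofReal T ∧
    ∀ t ∈ E, ∀ (x : PathSp n h T) (s₁ s₂ : Euc n),
      |H t x s₁ - H t x s₂| ≤ cH t * (1 + ‖stopPath t x‖) * ‖s₁ - s₂‖

/-- Condition (A.5) for a given compact set `D` and function `m_H(·;D)`. -/
def CondA5For {n : ℕ} {h T : ℝ} (H : ℝ → PathSp n h T → Euc n → ℝ)
    (D : Set (PathSp n h T)) (m : ℝ → ℝ) : Prop :=
  IntegNonneg T m ∧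
  ∀ x ∈ D, ∃ E : Set ℝ, E ⊆ Set.Icc 0 T ∧ volume E = ENNReal.ofReal T ∧
    ∀ t ∈ E, |H t x (0 : Euc n)| ≤ m t

/-- Condition (A.5). -/
def CondA5 {n : ℕ} {h T : ℝ} (H : ℝ → PathSp n h T → Euc n → ℝ) : Prop :=
  ∀ D : Set (PathSp n h T), IsCompact D → ∃ m : ℝ → ℝ, CondA5For H D m

/-- Conditions (A.1)–(A.5), with the function `c_H(·)` from (A.4) made explicit. -/
def CondA {n : ℕ} {h T : ℝ} (H : ℝ → PathSp n h T → Euc n → ℝ) (cH : ℝ → ℝ) : Prop :=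
  CondA1 H ∧ CondA2 H ∧ CondA3 H ∧ CondA4 H cH ∧ CondA5 H

/-- A functional `φ` on `[0,T] × C` is non-anticipative. -/
def NonAnticipative {n : ℕ} {h T : ℝ} (φ : ℝ → PathSp n h T → ℝ) : Prop :=
  ∀ t ∈ Set.Icc (0:ℝ) T, ∀ x : PathSp n h T, φ t x = φ t (stopPath t x)

/-- Property (U) from the definition of an upper solution. -/
def PropU {n : ℕ} {h T : ℝ} (H : ℝ → PathSp n h T → Euc n → ℝ) (cH : ℝ → ℝ)
    (φ : ℝ → PathSp n h T → ℝ) : Prop :=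
  ∀ t ∈ Set.Ico (0:ℝ) T, ∀ x : PathSp n h T, ∀ s : Euc n, ∀ τ ∈ Set.Ioc t T,
    ∃ p ∈ YPair t x cH,
      φ τ p.1 - ∫ ξ in t..τ, (@inner ℝ _ _ s (p.2 ξ) - H ξ p.1 s) ≤ φ t x

/-- Property (L) from the definition of a lower solution. -/
def PropL {n : ℕ} {h T : ℝ} (H : ℝ → PathSp n h T → Euc n → ℝ) (cH : ℝ → ℝ)
    (φ : ℝ → PathSp n h T → ℝ) : Prop :=
  ∀ t ∈ Set.Ico (0:ℝ) T, ∀ x : PathSp n h T, ∀ s : Euc n, ∀ τ ∈ Set.Ioc t T,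
    ∃ p ∈ YPair t x cH,
      φ t x ≤ φ τ p.1 - ∫ ξ in t..τ, (@inner ℝ _ _ s (p.2 ξ) - H ξ p.1 s)

/-- Upper solution of the Cauchy problem for `H` (with `c_H` from (A.4)) and `σ`. -/
def UpperSol {n : ℕ} {h T : ℝ} (H : ℝ → PathSp n h T → Euc n → ℝ) (cH : ℝ → ℝ)
    (σ : PathSp n h T → ℝ) (φ : ℝ → PathSp n h T → ℝ) : Prop :=
  NonAnticipative φ ∧
  LowerSemicontinuousOn (fun p : ℝ × PathSp n h T => φ p.1 p.2)
    (Set.Icc 0 T ×ˢ (Set.univ : Set (PathSp n h T))) ∧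
  (∀ x : PathSp n h T, σ x ≤ φ T x) ∧
  PropU H cH φ

/-- Lower solution of the Cauchy problem for `H` (with `c_H` from (A.4)) and `σ`. -/
def LowerSol {n : ℕ} {h T : ℝ} (H : ℝ → PathSp n h T → Euc n → ℝ) (cH : ℝ → ℝ)
    (σ : PathSp n h T → ℝ) (φ : ℝ → PathSp n h T → ℝ) : Prop :=
  NonAnticipative φ ∧
  UpperSemicontinuousOn (fun p : ℝ × PathSp n h T => φ p.1 p.2)
    (Set.Icc 0 T ×ˢ (Set.univ : Set (PathSp n h T))) ∧
  (∀ x : PathSp n h T, φ T x ≤ σ x) ∧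
  PropL H cH φ

/-- Minimax solution of the Cauchy problem. -/
def MinimaxSol {n : ℕ} {h T : ℝ} (H : ℝ → PathSp n h T → Euc n → ℝ) (cH : ℝ → ℝ)
    (σ : PathSp n h T → ℝ) (φ : ℝ → PathSp n h T → ℝ) : Prop :=
  UpperSol H cH σ φ ∧ LowerSol H cH σ φ

/-- `φ` is ci-differentiable at `(t,x(·))` with ci-derivatives `a = ∂ₜφ(t,x(·))`
and `g = ∇φ(t,x(·))`. -/
def HasCiDeriv {n : ℕ} {h T : ℝ} (φ : ℝ → PathSp n h T → ℝ)
    (t : ℝ) (x : PathSp n h T) (a : ℝ) (g : Euc n) : Prop :=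
  ∀ p ∈ ACPair t x, ∃ o : ℝ → ℝ,
    (∀ τ ∈ Set.Ioc t T,
      φ τ p.1 - φ t x =
        a * (τ - t) + @inner ℝ _ _ g (evalP p.1 τ - evalP x t) + o (τ - t)) ∧
    Tendsto (fun τ => o (τ - t) / (τ - t + ∫ ξ in t..τ, ‖p.2 ξ‖))
      (nhdsWithin t (Set.Ioi t)) (nhds 0)

/-- `φ ∈ Φ`, with the ci-derivatives `Dt = ∂ₜφ`, `Dx = ∇φ` and the full-measure
set `Eφ` of ci-differentiability made explicit. -/
structure IsInPhi {n : ℕ} {h T : ℝ} (φ : ℝ → PathSp n h T → ℝ)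
    (Dt : ℝ → PathSp n h T → ℝ) (Dx : ℝ → PathSp n h T → Euc n)
    (Eφ : Set ℝ) : Prop where
  cont : ContinuousOn (fun p : ℝ × PathSp n h T => φ p.1 p.2)
    (Set.Icc 0 T ×ˢ (Set.univ : Set (PathSp n h T)))
  absCont : ∀ t ∈ Set.Ico (0:ℝ) T, ∀ x : PathSp n h T, ∀ p ∈ ACPair t x,
    ∀ θ ∈ Set.Ioo t T, ∃ g : ℝ → ℝ, IntervalIntegrable g volume t θ ∧
      ∀ τ ∈ Set.Icc t θ, φ τ p.1 = φ t p.1 + ∫ ξ in t..τ, g ξ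
  Esub : Eφ ⊆ Set.Ico 0 T
  Efull : volume Eφ = ENNReal.ofReal T
  ciDiff : ∀ t ∈ Eφ, ∀ x : PathSp n h T, HasCiDeriv φ t x (Dt t x) (Dx t x)
  measD : ∀ x : PathSp n h T, Measurable (Eφ.restrict (fun t => (Dt t x, Dx t x)))
  contD : ∀ t ∈ Eφ, Continuous (fun x : PathSp n h T => (Dt t x, Dx t x))
  bddD : ∀ D : Set (PathSp n h T), IsCompact D → ∀ θ ∈ Set.Ico (0:ℝ) T,
    ∃ m : ℝ → ℝ, (IntegrableOn m (Set.Icc 0 θ) volume ∧ ∀ τ ∈ Set.Icc (0:ℝ) θ, 0 ≤ m τ) ∧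
      ∃ ℓ : ℝ, 0 < ℓ ∧ ∀ t ∈ Eφ ∩ Set.Icc 0 θ, ∀ x ∈ D, |Dt t x| ≤ m t ∧ ‖Dx t x‖ ≤ ℓ

/-- Semiclassical solution of the Cauchy problem (with derivative data). -/
def SemiclassicalSol {n : ℕ} {h T : ℝ} (H : ℝ → PathSp n h T → Euc n → ℝ)
    (σ : PathSp n h T → ℝ) (φ : ℝ → PathSp n h T → ℝ)
    (Dt : ℝ → PathSp n h T → ℝ) (Dx : ℝ → PathSp n h T → Euc n) (Eφ : Set ℝ) : Prop :=
  IsInPhi φ Dt Dx Eφ ∧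
  (∀ t ∈ Eφ, ∀ x : PathSp n h T, Dt t x + H t x (Dx t x) = 0) ∧
  ∀ x : PathSp n h T, φ T x = σ x

/-- The Steklov transform of `H` with respect to the first (time) variable,
with `H` extended by `0` outside `[0,T]`. -/
def steklov {n : ℕ} {h T : ℝ} (H : ℝ → PathSp n h T → Euc n → ℝ) (k : ℕ)
    (t : ℝ) (x : PathSp n h T) (s : Euc n) : ℝ :=
  ((k : ℝ) / 2) * ∫ τ in (t - (k : ℝ)⁻¹)..(t + (k : ℝ)⁻¹),
    (if τ ∈ Set.Icc (0:ℝ) T then H τ (stopPath t x) s else 0)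

/-! ### Differential game definitions -/

/-- Admissible controls with values in `P`. -/
def Ctrl {m : ℕ} (P : Set (Euc m)) : Set (ℝ → Euc m) :=
  {u | Measurable u ∧ ∀ τ, u τ ∈ P}

/-- Non-anticipative strategies mapping `Q`-valued controls to `P`-valued controls
on the interval `[t,T]`. -/
def NAStrat {mP mQ : ℕ} (P : Set (Euc mP)) (Q : Set (Euc mQ)) (t T : ℝ) :
    Set ((ℝ → Euc mQ) → ℝ → Euc mP) :=
  {α | (∀ v ∈ Ctrl Q, α v ∈ Ctrl P) ∧
    ∀ τ ∈ Set.Icc t T, ∀ v ∈ Ctrl Q, ∀ v' ∈ Ctrl Q,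
      (∀ᵐ ξ ∂(volume.restrict (Set.Icc t τ)), v ξ = v' ξ) →
      (∀ᵐ ξ ∂(volume.restrict (Set.Icc t τ)), α v ξ = α v' ξ)}

/-- `(y, y')` is (the derivative-witnessed) motion of the time-delay system
generated by `f` from `(t,x(·))` under controls `u(·)`, `v(·)`. -/
def IsMotion {n : ℕ} {h T : ℝ} {mP mQ : ℕ}
    (f : ℝ → PathSp n h T → Euc mP → Euc mQ → Euc n)
    (t : ℝ) (x : PathSp n h T) (u : ℝ → Euc mP) (v : ℝ → Euc mQ)
    (p : PathSp n h T × (ℝ → Euc n)) : Prop :=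
  p ∈ ACPair t x ∧
  ∀ᵐ τ ∂(volume.restrict (Set.Icc t T)), p.2 τ = f τ p.1 (u τ) (v τ)

/-- The set of values of the cost functional along motions (a singleton when
the motion exists and is unique). -/
def costVals {n : ℕ} {h T : ℝ} {mP mQ : ℕ}
    (f : ℝ → PathSp n h T → Euc mP → Euc mQ → Euc n)
    (χ : ℝ → PathSp n h T → Euc mP → Euc mQ → ℝ) (σ : PathSp n h T → ℝ)
    (t : ℝ) (x : PathSp n h T) (u : ℝ → Euc mP) (v : ℝ → Euc mQ) : Set ℝ :=
  {r | ∃ p : PathSp n h T × (ℝ → Euc n), IsMotion f t x u v p ∧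
        r = σ p.1 - ∫ τ in t..T, χ τ p.1 (u τ) (v τ)}

/-- The lower value `ρ⁻(t,x(·))` of the differential game. -/
def lowerValue {n : ℕ} {h T : ℝ} {mP mQ : ℕ} (P : Set (Euc mP)) (Q : Set (Euc mQ))
    (f : ℝ → PathSp n h T → Euc mP → Euc mQ → Euc n)
    (χ : ℝ → PathSp n h T → Euc mP → Euc mQ → ℝ) (σ : PathSp n h T → ℝ)
    (t : ℝ) (x : PathSp n h T) : ℝ :=
  sInf ((fun α => sSup (⋃ v ∈ Ctrl Q, costVals f χ σ t x (α v) v)) '' NAStrat P Q t T)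

/-- The upper value `ρ⁺(t,x(·))` of the differential game. -/
def upperValue {n : ℕ} {h T : ℝ} {mP mQ : ℕ} (P : Set (Euc mP)) (Q : Set (Euc mQ))
    (f : ℝ → PathSp n h T → Euc mP → Euc mQ → Euc n)
    (χ : ℝ → PathSp n h T → Euc mP → Euc mQ → ℝ) (σ : PathSp n h T → ℝ)
    (t : ℝ) (x : PathSp n h T) : ℝ :=
  sSup ((fun β => sInf (⋃ u ∈ Ctrl P, costVals f χ σ t x u (β u))) '' NAStrat Q P t T)

/-- The lower Hamiltonian `H⁻` (defined via the full-measure set `EC` from (C.2)). -/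
def Hlow {n : ℕ} {h T : ℝ} {mP mQ : ℕ} (P : Set (Euc mP)) (Q : Set (Euc mQ))
    (f : ℝ → PathSp n h T → Euc mP → Euc mQ → Euc n)
    (χ : ℝ → PathSp n h T → Euc mP → Euc mQ → ℝ) (EC : Set ℝ)
    (τ : ℝ) (y : PathSp n h T) (s : Euc n) : ℝ :=
  if τ ∈ EC then
    sSup ((fun v => sInf ((fun u => @inner ℝ _ _ s (f τ y u v) - χ τ y u v) '' P)) '' Q)
  else 0

/-- The upper Hamiltonian `H⁺` (defined via the full-measure set `EC` from (C.2)). -/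
def Hup {n : ℕ} {h T : ℝ} {mP mQ : ℕ} (P : Set (Euc mP)) (Q : Set (Euc mQ))
    (f : ℝ → PathSp n h T → Euc mP → Euc mQ → Euc n)
    (χ : ℝ → PathSp n h T → Euc mP → Euc mQ → ℝ) (EC : Set ℝ)
    (τ : ℝ) (y : PathSp n h T) (s : Euc n) : ℝ :=
  if τ ∈ EC then
    sInf ((fun u => sSup ((fun v => @inner ℝ _ _ s (f τ y u v) - χ τ y u v) '' Q)) '' P)
  else 0

/-- Assumption (C) on the data `(f, χ, σ)` of the differential game, with the
full-measure set `EC` from (C.2) and the function `c_f(·)` from (C.4) explicit. -/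
structure AssumpC {n : ℕ} {h T : ℝ} {mP mQ : ℕ} (P : Set (Euc mP)) (Q : Set (Euc mQ))
    (f : ℝ → PathSp n h T → Euc mP → Euc mQ → Euc n)
    (χ : ℝ → PathSp n h T → Euc mP → Euc mQ → ℝ)
    (σ : PathSp n h T → ℝ) (EC : Set ℝ) (cf : ℝ → ℝ) : Prop where
  meas : ∀ (y : PathSp n h T) (u : Euc mP) (v : Euc mQ),
    Measurable ((Set.Icc (0:ℝ) T).restrict (fun τ => (f τ y u v, χ τ y u v)))
  ECsub : EC ⊆ Set.Icc 0 T
  ECfull : volume EC = ENNReal.ofReal T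
  contOn : ∀ τ ∈ EC, ContinuousOn
    (fun p : PathSp n h T × Euc mP × Euc mQ => (f τ p.1 p.2.1 p.2.2, χ τ p.1 p.2.1 p.2.2))
    ((Set.univ : Set (PathSp n h T)) ×ˢ P ×ˢ Q)
  lip : ∀ D : Set (PathSp n h T), IsCompact D → ∃ lam : ℝ → ℝ, IntegNonneg T lam ∧
    ∃ E : Set ℝ, E ⊆ Set.Icc 0 T ∧ volume E = ENNReal.ofReal T ∧
      ∀ τ ∈ E, ∀ y₁ ∈ D, ∀ y₂ ∈ D, ∀ u ∈ P, ∀ v ∈ Q,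
        ‖f τ y₁ u v - f τ y₂ u v‖ + |χ τ y₁ u v - χ τ y₂ u v| ≤
          lam τ * ‖stopPath τ y₁ - stopPath τ y₂‖
  growth : IntegNonneg T cf ∧
    ∃ E : Set ℝ, E ⊆ Set.Icc 0 T ∧ volume E = ENNReal.ofReal T ∧
      ∀ τ ∈ E, ∀ y : PathSp n h T, ∀ u ∈ P, ∀ v ∈ Q,
        ‖f τ y u v‖ ≤ cf τ * (1 + ‖stopPath τ y‖)
  bdd : ∀ D : Set (PathSp n h T), IsCompact D → ∃ m : ℝ → ℝ, IntegNonneg T m ∧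
    ∃ E : Set ℝ, E ⊆ Set.Icc 0 T ∧ volume E = ENNReal.ofReal T ∧
      ∀ τ ∈ E, ∀ y ∈ D, ∀ u ∈ P, ∀ v ∈ Q, |χ τ y u v| ≤ m τ
  sigC : Continuous σ


lemma aux_ac_deriv {n : ℕ} {a b : ℝ} (hab : a ≤ b) (f : ℝ → Euc n) (g : ℝ → ℝ)
    (hg : IntervalIntegrable g volume a b)
    (hfg : ∀ σ τ, a ≤ σ → σ ≤ τ → τ ≤ b → ‖f τ - f σ‖ ≤ ∫ ξ in σ..τ, g ξ) :
    ∃ v : ℝ → Euc n, IntervalIntegrable v volume a b ∧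
      (∀ τ ∈ Set.Icc a b, f τ = f a + ∫ ξ in a..τ, v ξ) ∧
      ∀ᵐ τ ∂(volume.restrict (Set.Icc a b)), ‖v τ‖ ≤ g τ := by
  have hgi : ∀ σ ∈ Icc a b, ∀ τ ∈ Icc a b, IntervalIntegrable g volume σ τ := by
    intro σ hσ τ hτ
    apply hg.mono_set
    rw [uIcc_of_le hab]
    exact uIcc_subset_Icc hσ hτ
  set G : ℝ → ℝ := fun τ => ∫ ξ in a..τ, g ξ with hG
  have ha : a ∈ Icc a b := ⟨le_rfl, hab⟩
  have hGs : ∀ σ ∈ Icc a b, ∀ τ ∈ Icc a b, ∫ ξ in σ..τ, g ξ = G τ - G σ := by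
    intro σ hσ τ hτ
    simp only [hG]
    rw [intervalIntegral.integral_interval_sub_left (hgi _ ha _ hτ) (hgi _ ha _ hσ)]
  have hdist : ∀ σ ∈ Icc a b, ∀ τ ∈ Icc a b, dist (f σ) (f τ) ≤ dist (G σ) (G τ) := by
    intro σ hσ τ hτ
    rcases le_total σ τ with h | h
    · rw [dist_comm, dist_eq_norm, dist_comm, Real.dist_eq, ← hGs σ hσ τ hτ]
      exact (hfg σ τ hσ.1 h hτ.2).trans (le_abs_self _)
    · rw [dist_eq_norm, Real.dist_eq, ← hGs τ hτ σ hσ]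
      exact (hfg τ σ hτ.1 h hσ.2).trans (le_abs_self _)
  have hGac : AbsolutelyContinuousOnInterval G a b :=
    hg.absolutelyContinuousOnInterval_intervalIntegral (c := a) (by simp)
  have hfi : ∀ i, AbsolutelyContinuousOnInterval (fun s => f s i) a b := by
    intro i
    rw [absolutelyContinuousOnInterval_iff] at hGac ⊢
    intro ε hε
    obtain ⟨δ, hδ, H⟩ := hGac ε hε
    refine ⟨δ, hδ, fun E hE hlt => lt_of_le_of_lt (Finset.sum_le_sum fun j hj => ?_) (H E hE hlt)⟩
    have h1 := hE.1 j hj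
    rw [uIcc_of_le hab] at h1
    refine le_trans ?_ (hdist _ h1.1 _ h1.2)
    rw [Real.dist_eq, dist_eq_norm]
    exact PiLp.norm_apply_le (f (E.2 j).1 - f (E.2 j).2) i
  set v : ℝ → Euc n := fun ξ => WithLp.toLp 2 (fun i => deriv (fun s => f s i) ξ) with hv
  have hvi : IntervalIntegrable v volume a b := by
    have h0 : ∀ i, IntervalIntegrable (deriv (fun s => f s i)) volume a b :=
      fun i => (hfi i).intervalIntegrable_deriv
    rw [intervalIntegrable_iff]
    have h1 : Integrable (fun ξ => fun i => deriv (fun s => f s i) ξ)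
        (volume.restrict (uIoc a b)) :=
      Integrable.of_eval fun i => (intervalIntegrable_iff.1 (h0 i))
    exact (PiLp.continuousLinearEquiv 2 ℝ (fun _ : Fin n => ℝ)).symm.toContinuousLinearMap.integrable_comp h1
  refine ⟨v, hvi, ?_, ?_⟩
  · intro τ hτ
    ext i
    have hsub : uIcc a τ ⊆ uIcc a b := by
      rw [uIcc_of_le hab]; exact uIcc_subset_Icc ha hτ
    have h1 := ((hfi i).mono hsub).integral_deriv_eq_sub
    have h2 : (∫ ξ in a..τ, v ξ) i = ∫ ξ in a..τ, v ξ i := by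
      have := (PiLp.proj (𝕜 := ℝ) 2 (fun _ : Fin n => ℝ) i).intervalIntegral_comp_comm
        (hvi.mono_set hsub)
      simpa using this.symm
    rw [PiLp.add_apply, h2]
    have h3 : ∫ ξ in a..τ, v ξ i = ∫ ξ in a..τ, deriv (fun s => f s i) ξ := rfl
    rw [h3, h1]; ring
  · rw [ae_restrict_iff' measurableSet_Icc]
    have h1 : ∀ᵐ x, x ≠ a := by simp [ae_iff, measure_singleton]
    have h2 : ∀ᵐ x, x ≠ b := by simp [ae_iff, measure_singleton]
    have h3 : ∀ᵐ x, ∀ i, x ∈ uIcc a b → DifferentiableAt ℝ (fun s => f s i) x :=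
      ae_all_iff.2 fun i => (hfi i).ae_differentiableAt
    filter_upwards [h1, h2, h3, hg.ae_hasDerivAt_integral] with ξ hξa hξb hd hGd hξ
    have hξ' : ξ ∈ uIcc a b := by rwa [uIcc_of_le hab]
    have hfd : HasDerivAt f (v ξ) ξ := by
      have h5 : HasDerivAt (fun s => fun i => f s i) (fun i => deriv (fun s => f s i) ξ) ξ :=
        hasDerivAt_pi.2 fun i => (hd i hξ').hasDerivAt
      exact (PiLp.continuousLinearEquiv 2 ℝ
        (fun _ : Fin n => ℝ)).symm.toContinuousLinearMap.hasFDerivAt.comp_hasDerivAt ξ h5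
    have hGd' : HasDerivAt G (g ξ) ξ := hGd hξ' a (by simp)
    have hlt : ξ < b := lt_of_le_of_ne hξ.2 hξb
    have e1 := (hasDerivAt_iff_tendsto_slope_left_right.1 hfd).2.norm
    have e2 := (hasDerivAt_iff_tendsto_slope_left_right.1 hGd').2
    refine le_of_tendsto_of_tendsto e1 e2 ?_
    filter_upwards [Ioo_mem_nhdsGT hlt] with s hs
    have hsI : s ∈ Icc a b := ⟨hξ.1.trans hs.1.le, hs.2.le⟩
    have h4 := hfg ξ s hξ.1 hs.1.le hs.2.le
    rw [hGs _ hξ _ hsI] at h4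
    have hp : 0 < s - ξ := sub_pos.2 hs.1
    rw [slope_def_module, slope_def_module, norm_smul, norm_inv, Real.norm_of_nonneg hp.le,
      smul_eq_mul]
    gcongr

lemma aux_arzela {X E : Type*} [TopologicalSpace X] [CompactSpace X] [NormedAddCommGroup E]
    [ProperSpace E] (f : ℕ → C(X, E)) (R : ℝ) (hR : ∀ k, ‖f k‖ ≤ R)
    (heq : ∀ p : X, ∀ ε > 0, ∃ U ∈ 𝓝 p, ∀ᶠ k in atTop, ∀ q ∈ U, dist (f k p) (f k q) < ε) :
    ∃ κ : ℕ → ℕ, StrictMono κ ∧ ∃ y, Tendsto (fun i => f (κ i)) atTop (𝓝 y) := by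
  have hequi : ∀ p : X, ∀ ε > 0, ∃ U ∈ 𝓝 p, ∀ k, ∀ q ∈ U, dist (f k p) (f k q) < ε := by
    intro p ε hε
    obtain ⟨U, hU, hk⟩ := heq p ε hε
    obtain ⟨N, hN⟩ := eventually_atTop.1 hk
    refine ⟨U ∩ ⋂ k ∈ Finset.range N, {q | dist (f k p) (f k q) < ε}, ?_, ?_⟩
    · refine inter_mem hU ((biInter_finset_mem _).2 fun k _ => ?_)
      have : Continuous fun q => dist (f k p) (f k q) := by fun_prop
      exact this.continuousAt.eventually_lt continuousAt_const (by simpa using hε)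
    · intro k q hq
      by_cases hkN : N ≤ k
      · exact hN k hkN q hq.1
      · exact mem_iInter₂.1 hq.2 k (Finset.mem_range.2 (not_le.1 hkN))
  set e := ContinuousMap.isometryEquivBoundedOfCompact X E
  have hcomp := BoundedContinuousFunction.arzela_ascoli (Metric.closedBall (0:E) R)
    (isCompact_closedBall 0 R) (range fun k => e (f k)) (by
      rintro _ x ⟨k, rfl⟩
      rw [mem_closedBall_zero_iff]
      exact ((f k).norm_coe_le_norm x).trans (hR k)) (by
      intro p
      rw [Metric.equicontinuousAt_iff_right]
      intro ε hε
      obtain ⟨U, hU, H⟩ := hequi p ε hε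
      filter_upwards [hU] with q hq
      rintro ⟨_, k, rfl⟩
      exact H k q hq)
  obtain ⟨z, -, κ, hκ, hz⟩ := hcomp.tendsto_subseq (x := fun k => e (f k))
    (fun k => subset_closure ⟨k, rfl⟩)
  refine ⟨κ, hκ, e.symm z, ?_⟩
  have := (e.symm.continuous.tendsto z).comp hz
  simpa [Function.comp_def] using this

lemma aux_evalP {n : ℕ} {h T : ℝ} (hc : -h ≤ T) (x : PathSp n h T) (τ : ℝ) :
    evalP x τ = x (Set.projIcc (-h) T hc τ) := by simp [evalP, hc]

lemma aux_evalP_cont {n : ℕ} {h T : ℝ} (hc : -h ≤ T) (x : PathSp n h T) :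
    Continuous (evalP x) := by
  have : evalP x = fun τ => x (Set.projIcc (-h) T hc τ) := funext (aux_evalP hc x)
  rw [this]
  exact x.continuous.comp continuous_projIcc

lemma aux_norm_evalP {n : ℕ} {h T : ℝ} (hc : -h ≤ T) (x : PathSp n h T) (τ : ℝ) :
    ‖evalP x τ‖ ≤ ‖x‖ := by
  rw [aux_evalP hc]; exact x.norm_coe_le_norm _

lemma aux_evalP_sub {n : ℕ} {h T : ℝ} (hc : -h ≤ T) (x y : PathSp n h T) (τ : ℝ) :
    evalP (x - y) τ = evalP x τ - evalP y τ := by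
  simp [aux_evalP hc]

lemma aux_evalP_tendsto {n : ℕ} {h T : ℝ} (hc : -h ≤ T) {xk : ℕ → PathSp n h T} {x : PathSp n h T}
    {s : ℕ → ℝ} {s₀ : ℝ} (hx : Tendsto xk atTop (𝓝 x)) (hs : Tendsto s atTop (𝓝 s₀)) :
    Tendsto (fun k => evalP (xk k) (s k)) atTop (𝓝 (evalP x s₀)) := by
  have hf : Continuous fun p : PathSp n h T × Icc (-h) T => p.1 p.2 := by fun_prop
  simp only [aux_evalP hc]
  have := (hf.tendsto (x, projIcc (-h) T hc s₀)).comp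
    (hx.prodMk_nhds ((continuous_projIcc (h := hc)).continuousAt.tendsto.comp hs))
  exact this

lemma aux_stopTime_idem {h T σ τ : ℝ} (hστ : σ ≤ τ) (p : Icc (-h) T) :
    stopTime h T τ (stopTime h T σ p) = stopTime h T σ p := by
  apply Subtype.ext
  simp only [stopTime]
  grind

lemma aux_stop_mono {n : ℕ} {h T : ℝ} (y : PathSp n h T) :
    Monotone fun τ => ‖stopPath τ y‖ := by
  intro σ τ hστ
  refine (ContinuousMap.norm_le _ (norm_nonneg _)).2 fun p => ?_
  have : stopPath σ y p = stopPath τ y (stopTime h T σ p) := by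
    change y _ = y (stopTime h T τ (stopTime h T σ p))
    rw [aux_stopTime_idem hστ]; rfl
  rw [this]
  exact ContinuousMap.norm_coe_le_norm _ _

lemma aux_stop_le {n : ℕ} {h T : ℝ} (y : PathSp n h T) (τ : ℝ) : ‖stopPath τ y‖ ≤ ‖y‖ := by
  refine (ContinuousMap.norm_le _ (norm_nonneg _)).2 fun p => ?_
  exact ContinuousMap.norm_coe_le_norm y (stopTime h T τ p)

lemma aux_stop_sub {n : ℕ} {h T : ℝ} (y z : PathSp n h T) (τ : ℝ) :
    ‖stopPath τ y‖ ≤ ‖stopPath τ z‖ + ‖y - z‖ := by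
  have h1 : stopPath τ y = stopPath τ z + stopPath τ (y - z) := by
    ext p; simp [stopPath]
  rw [h1]
  exact (norm_add_le _ _).trans (by gcongr; exact aux_stop_le _ _)

lemma aux_evalP_le_stopped {n : ℕ} {h T : ℝ} (hc : -h ≤ T) (y : PathSp n h T) {s τ : ℝ}
    (hs : s ≤ τ) : ‖evalP y s‖ ≤ ‖stopPath τ y‖ := by
  rw [aux_evalP hc]
  have : projIcc (-h) T hc s = stopTime h T τ (projIcc (-h) T hc s) := by
    apply Subtype.ext
    simp only [stopTime, projIcc]
    grind
  rw [this]
  exact ContinuousMap.norm_coe_le_norm (stopPath τ y) _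

lemma aux_stop_le_of {n : ℕ} {h T : ℝ} (hc : -h ≤ T) (y : PathSp n h T) {τ r : ℝ} (hr : 0 ≤ r)
    (hτ : -h ≤ τ) (H : ∀ s ≤ τ, ‖evalP y s‖ ≤ r) : ‖stopPath τ y‖ ≤ r := by
  refine (ContinuousMap.norm_le _ hr).2 fun p => ?_
  have h1 : stopPath τ y p = evalP y (stopTime h T τ p).1 := by
    rw [aux_evalP hc, projIcc_val]; rfl
  rw [h1]
  apply H
  exact max_le hτ (min_le_right _ _)

lemma aux_evalP_stopped {n : ℕ} {h T : ℝ} (hc : -h ≤ T) {x y : PathSp n h T} {t : ℝ}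
    (ht : -h ≤ t) (hxy : stopPath t y = stopPath t x) (τ : ℝ) :
    evalP y (min τ t) = evalP x (min τ t) := by
  have h2 : projIcc (-h) T hc (min τ t) = stopTime h T t (projIcc (-h) T hc (min τ t)) := by
    apply Subtype.ext
    simp only [stopTime, projIcc]
    grind
  rw [aux_evalP hc, aux_evalP hc, h2]
  exact DFunLike.congr_fun hxy _

/-- Extension of a function on `[0,T]` by zero. -/
def cExt (T : ℝ) (c : ℝ → ℝ) : ℝ → ℝ := (Set.Icc 0 T).indicator c

lemma cExt_int {T : ℝ} {c : ℝ → ℝ} (hc : IntegNonneg T c) : Integrable (cExt T c) :=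
  (integrable_indicator_iff measurableSet_Icc).2 hc.1

lemma cExt_nonneg {T : ℝ} {c : ℝ → ℝ} (hc : IntegNonneg T c) (τ : ℝ) : 0 ≤ cExt T c τ :=
  Set.indicator_nonneg hc.2 τ

lemma cExt_mul_int {n : ℕ} {h T : ℝ} {c : ℝ → ℝ} (hc : IntegNonneg T c) (y : PathSp n h T) :
    Integrable fun ξ => cExt T c ξ * (1 + ‖stopPath ξ y‖) := by
  refine (cExt_int hc).mul_bdd (c := 1 + ‖y‖) ?_ ?_
  · exact ((aux_stop_mono y).measurable.const_add 1).aestronglyMeasurable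
  · refine ae_of_all _ fun ξ => ?_
    rw [Real.norm_of_nonneg (by positivity)]
    gcongr; exact aux_stop_le _ _

lemma cExt_L1 {T : ℝ} {c d : ℝ → ℝ} :
    ∫ ξ, |cExt T c ξ - cExt T d ξ| = L1dist T c d := by
  rw [L1dist, ← integral_indicator measurableSet_Icc]
  congr 1
  ext ξ
  by_cases hξ : ξ ∈ Icc 0 T <;> simp [cExt, hξ]

lemma cExt_L1' {T : ℝ} {c d : ℝ → ℝ} (hc : IntegNonneg T c) (hd : IntegNonneg T d) {σ τ : ℝ}
    (h : σ ≤ τ) : ∫ ξ in σ..τ, |cExt T c ξ - cExt T d ξ| ≤ L1dist T c d := by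
  rw [← cExt_L1, intervalIntegral.integral_of_le h]
  exact setIntegral_le_integral ((cExt_int hc).sub (cExt_int hd)).abs
    (ae_of_all _ fun _ => abs_nonneg _)

lemma aux_est {n : ℕ} {h T : ℝ} (hT : 0 < T) (hh : 0 ≤ h) {t : ℝ} (ht : t ∈ Icc 0 T)
    {x y : PathSp n h T} {c : ℝ → ℝ} (hc : IntegNonneg T c) (hy : y ∈ YSet t x c)
    {σ τ : ℝ} (hστ : σ ≤ τ) (hτ : τ ≤ T) :
    ‖evalP y τ - evalP y σ‖ ≤ ‖evalP x (min τ t) - evalP x (min σ t)‖ +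
      ∫ ξ in σ..τ, cExt T c ξ * (1 + ‖stopPath ξ y‖) := by
  obtain ⟨v, ⟨hst, hvi, hint⟩, hbd⟩ := hy
  have hcT : -h ≤ T := by linarith
  simp only at hst hvi hint hbd
  have hdec : ∀ s, evalP y s = evalP x (min s t) + evalP y (max s t) - evalP y t := by
    intro s
    rw [← aux_evalP_stopped hcT (by linarith [ht.1]) hst]
    rcases le_total s t with h | h
    · simp [h]
    · simp [h]
  have hvi' : ∀ s ∈ Icc t T, IntervalIntegrable v volume t s := fun s hs =>
    hvi.mono_set (by rw [uIcc_of_le ht.2]; exact uIcc_subset_Icc ⟨le_rfl, ht.2⟩ hs)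
  have hm1 : max τ t ∈ Icc t T := ⟨le_max_right _ _, max_le hτ ht.2⟩
  have hm2 : max σ t ∈ Icc t T := ⟨le_max_right _ _, max_le (hστ.trans hτ) ht.2⟩
  have hle : max σ t ≤ max τ t := max_le_max_right _ hστ
  have hdiff : evalP y (max τ t) - evalP y (max σ t) = ∫ ξ in (max σ t)..(max τ t), v ξ := by
    rw [hint _ hm1, hint _ hm2,
      ← intervalIntegral.integral_interval_sub_left (hvi' _ hm1) (hvi' _ hm2)]
    abel
  have hD : evalP y τ - evalP y σ = (evalP x (min τ t) - evalP x (min σ t)) +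
      (evalP y (max τ t) - evalP y (max σ t)) := by
    rw [hdec τ, hdec σ]; abel
  rw [hD]
  refine (norm_add_le _ _).trans (add_le_add le_rfl ?_)
  rw [hdiff, intervalIntegral.integral_of_le hle, intervalIntegral.integral_of_le hστ]
  have hI := cExt_mul_int hc y
  have hsub : Ioc (max σ t) (max τ t) ⊆ Icc t T := fun ξ hξ =>
    ⟨(le_max_right _ _).trans hξ.1.le, hξ.2.trans hm1.2⟩
  refine (norm_integral_le_of_norm_le (hI.integrableOn (s := Ioc (max σ t) (max τ t))) ?_).trans ?_
  · have h1 := ae_restrict_of_ae_restrict_of_subset hsub hbd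
    filter_upwards [h1, ae_restrict_mem measurableSet_Ioc] with ξ h2 h3
    have : ξ ∈ Icc 0 T := ⟨ht.1.trans (hsub h3).1, (hsub h3).2⟩
    simpa [cExt, this] using h2
  · refine setIntegral_mono_set hI.integrableOn (ae_of_all _ fun ξ => ?_) ?_
    · exact mul_nonneg (cExt_nonneg hc ξ) (by positivity)
    · refine LE.le.eventuallyLE fun ξ hξ => ?_
      simp only [mem_Ioc] at hξ ⊢
      grind


lemma aux_int_bound {n : ℕ} {h T : ℝ} {c : ℝ → ℝ} (hc : IntegNonneg T c) (y : PathSp n h T)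
    {σ τ : ℝ} (hστ : σ ≤ τ) :
    ∫ ξ in σ..τ, cExt T c ξ * (1 + ‖stopPath ξ y‖) ≤
      (1 + ‖stopPath τ y‖) * ∫ ξ in σ..τ, cExt T c ξ := by
  rw [← intervalIntegral.integral_const_mul]
  refine intervalIntegral.integral_mono_on hστ (cExt_mul_int hc y).intervalIntegrable
    ((cExt_int hc).intervalIntegrable.const_mul _) fun ξ hξ => ?_
  rw [mul_comm]
  exact mul_le_mul_of_nonneg_right (add_le_add le_rfl (aux_stop_mono y hξ.2)) (cExt_nonneg hc ξ)

lemma aux_int_conv {n : ℕ} {h T : ℝ} {c d : ℝ → ℝ} (hc : IntegNonneg T c) (hd : IntegNonneg T d)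
    (y z : PathSp n h T) {R : ℝ} (hR : ‖z‖ ≤ R) {σ τ : ℝ} (hστ : σ ≤ τ) :
    ∫ ξ in σ..τ, cExt T d ξ * (1 + ‖stopPath ξ z‖) ≤
      (∫ ξ in σ..τ, cExt T c ξ * (1 + ‖stopPath ξ y‖)) + (1 + R) * L1dist T d c +
        ‖z - y‖ * ∫ ξ in σ..τ, cExt T c ξ := by
  have i1 := (cExt_mul_int hc y).intervalIntegrable (a := σ) (b := τ)
  have i2 : IntervalIntegrable (fun ξ => (1 + R) * |cExt T d ξ - cExt T c ξ|) volume σ τ :=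
    (((cExt_int hd).sub (cExt_int hc)).abs.intervalIntegrable (a := σ) (b := τ)).const_mul (1 + R)
  have i3 := ((cExt_int hc).intervalIntegrable (a := σ) (b := τ)).const_mul ‖z - y‖
  have hR0 : 0 ≤ R := (norm_nonneg _).trans hR
  calc ∫ ξ in σ..τ, cExt T d ξ * (1 + ‖stopPath ξ z‖)
      ≤ ∫ ξ in σ..τ, (cExt T c ξ * (1 + ‖stopPath ξ y‖) +
          (1 + R) * |cExt T d ξ - cExt T c ξ| + ‖z - y‖ * cExt T c ξ) := by
        refine intervalIntegral.integral_mono_on hστ (cExt_mul_int hd z).intervalIntegrable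
          ((i1.add i2).add i3) fun ξ _ => ?_
        have h1 := aux_stop_sub z y ξ
        have h2 := (aux_stop_le z ξ).trans hR
        have h3 := cExt_nonneg hc ξ
        have h4 := le_abs_self (cExt T d ξ - cExt T c ξ)
        have h5 : (cExt T d ξ - cExt T c ξ) * (1 + ‖stopPath ξ z‖) ≤
            |cExt T d ξ - cExt T c ξ| * (1 + R) := by
          apply mul_le_mul h4 (by linarith) (by positivity) (abs_nonneg _)
        have h6 := mul_le_mul_of_nonneg_left h1 h3
        nlinarith
    _ = (∫ ξ in σ..τ, cExt T c ξ * (1 + ‖stopPath ξ y‖)) +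
          (1 + R) * (∫ ξ in σ..τ, |cExt T d ξ - cExt T c ξ|) +
          ‖z - y‖ * ∫ ξ in σ..τ, cExt T c ξ := by
        rw [intervalIntegral.integral_add (i1.add i2) i3, intervalIntegral.integral_add i1 i2,
          intervalIntegral.integral_const_mul, intervalIntegral.integral_const_mul]
    _ ≤ _ := by
        have := cExt_L1' hd hc hστ
        gcongr

lemma aux_stop_eval {n : ℕ} {h T t : ℝ} (hc : -h ≤ T) (ht : -h ≤ t) (z : PathSp n h T)
    (p : Icc (-h) T) : stopPath t z p = evalP z (min p.1 t) := by
  rw [aux_evalP hc]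
  have h2 : projIcc (-h) T hc (min p.1 t) = stopTime h T t p := by
    apply Subtype.ext
    have h3 := p.2.1
    have h4 := p.2.2
    simp only [stopTime, projIcc]
    grind
  rw [h2]; rfl

lemma aux_int_le {T : ℝ} {c d : ℝ → ℝ} (hc : IntegNonneg T c) (hd : IntegNonneg T d)
    {σ τ : ℝ} (hστ : σ ≤ τ) :
    ∫ ξ in σ..τ, cExt T d ξ ≤ (∫ ξ in σ..τ, cExt T c ξ) + L1dist T d c := by
  have i1 := (cExt_int hc).intervalIntegrable (a := σ) (b := τ)
  have i2 := ((cExt_int hd).sub (cExt_int hc)).abs.intervalIntegrable (a := σ) (b := τ)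
  calc ∫ ξ in σ..τ, cExt T d ξ
      ≤ ∫ ξ in σ..τ, (cExt T c ξ + |cExt T d ξ - cExt T c ξ|) := by
        refine intervalIntegral.integral_mono_on hστ (cExt_int hd).intervalIntegrable
          (i1.add i2) fun ξ _ => ?_
        have h4 := le_abs_self (cExt T d ξ - cExt T c ξ)
        linarith
    _ = (∫ ξ in σ..τ, cExt T c ξ) + ∫ ξ in σ..τ, |cExt T d ξ - cExt T c ξ| :=
        intervalIntegral.integral_add i1 i2
    _ ≤ _ := add_le_add le_rfl (cExt_L1' hd hc hστ)

/-- Proposition 1: compactness-type property of the sets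
`Y(t,x(·);c(·))` under convergence of the data. -/
theorem stmt0 {n : ℕ} {h T : ℝ} (hT : 0 < T) (hh : 0 ≤ h)
    (t : ℝ) (x : PathSp n h T) (tk : ℕ → ℝ) (xk : ℕ → PathSp n h T)
    (c : ℝ → ℝ) (ck : ℕ → ℝ → ℝ)
    (ht : t ∈ Set.Icc (0:ℝ) T) (htk : ∀ k, tk k ∈ Set.Icc (0:ℝ) T)
    (hc : IntegNonneg T c) (hck : ∀ k, IntegNonneg T (ck k))
    (hconv : Tendsto (fun k => |tk k - t| + ‖xk k - x‖ + L1dist T (ck k) c)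
      atTop (nhds 0))
    (yk : ℕ → PathSp n h T) (hyk : ∀ k, yk k ∈ YSet (tk k) (xk k) (ck k)) :
    ∃ κ : ℕ → ℕ, StrictMono κ ∧ ∃ y ∈ YSet t x c,
      Tendsto (fun i => ‖yk (κ i) - y‖) atTop (nhds 0) := by
  have hcT : -h ≤ T := by linarith
  have hL0 : ∀ k, 0 ≤ L1dist T (ck k) c := fun k => integral_nonneg fun _ => abs_nonneg _
  have hL : Tendsto (fun k => L1dist T (ck k) c) atTop (𝓝 0) :=
    squeeze_zero hL0 (fun k => by linarith [abs_nonneg (tk k - t), norm_nonneg (xk k - x)]) hconv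
  have hxk : Tendsto xk atTop (𝓝 x) := by
    rw [tendsto_iff_norm_sub_tendsto_zero]
    exact squeeze_zero (fun _ => norm_nonneg _)
      (fun k => by linarith [abs_nonneg (tk k - t), hL0 k]) hconv
  have htk' : Tendsto tk atTop (𝓝 t) := by
    rw [tendsto_iff_norm_sub_tendsto_zero]
    refine squeeze_zero (fun _ => norm_nonneg _)
      (fun k => ?_) hconv
    rw [Real.norm_eq_abs]
    linarith [norm_nonneg (xk k - x), hL0 k]
  set C : ℝ → ℝ := fun τ => ∫ ξ in (0:ℝ)..τ, cExt T c ξ with hCdef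
  have hCcont : Continuous C := (cExt_int hc).continuous_primitive 0
  have hCsub : ∀ σ τ, ∫ ξ in σ..τ, cExt T c ξ = C τ - C σ := fun σ τ =>
    (intervalIntegral.integral_interval_sub_left (cExt_int hc).intervalIntegrable
      (cExt_int hc).intervalIntegrable).symm
  have hck' : ∀ k σ τ, σ ≤ τ → ∫ ξ in σ..τ, cExt T (ck k) ξ ≤ C τ - C σ + L1dist T (ck k) c := by
    intro k σ τ hστ
    rw [← hCsub]
    exact aux_int_le hc (hck k) hστ
  -- uniform bound
  have hA : ∀ᶠ k in atTop, ‖xk k‖ < ‖x‖ + 1 :=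
    hxk.norm.eventually (gt_mem_nhds (by linarith))
  have hL4 : ∀ᶠ k in atTop, L1dist T (ck k) c < 1 / 4 := hL.eventually (gt_mem_nhds (by norm_num))
  obtain ⟨A, hAdef⟩ : ∃ A, A = ‖x‖ + 1 := ⟨_, rfl⟩
  rw [← hAdef] at hA
  have huc := isCompact_Icc (a := (0:ℝ)) (b := T) |>.uniformContinuousOn_of_continuous
    hCcont.continuousOn
  obtain ⟨δ, hδ, hδC⟩ := Metric.uniformContinuousOn_iff.1 huc (1 / 4) (by norm_num)
  have hstep : ∀ k, ‖xk k‖ < A → L1dist T (ck k) c < 1 / 4 → ∀ σ ∈ Icc 0 T, ∀ τ ∈ Icc 0 T,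
      σ ≤ τ → τ - σ < δ → ‖stopPath τ (yk k)‖ ≤ 2 * ‖stopPath σ (yk k)‖ + (4 * A + 1) := by
    intro k hxA hLk σ hσ τ hτ hστ hd
    have hA0 : 0 ≤ A := (norm_nonneg _).trans hxA.le
    have key : ‖stopPath τ (yk k)‖ ≤
        ‖stopPath σ (yk k)‖ + 2 * A + (1 + ‖stopPath τ (yk k)‖) * (1 / 2) := by
      refine aux_stop_le_of hcT _ (by positivity) (by linarith [hτ.1]) fun s hs => ?_
      rcases le_total s σ with hsσ | hsσ
      · have := aux_evalP_le_stopped hcT (yk k) hsσ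
        have h2 := norm_nonneg (stopPath τ (yk k))
        linarith
      · have h1 := aux_est hT hh (htk k) (hck k) (hyk k) hsσ (hs.trans hτ.2)
        have h2 := aux_int_bound (hck k) (yk k) hsσ
        have h3 := hck' k σ s hsσ
        have h4 := hδC σ hσ s ⟨hσ.1.trans hsσ, hs.trans hτ.2⟩ (by
          rw [dist_comm, Real.dist_eq, abs_of_nonneg (by linarith)]; linarith)
        rw [dist_comm, Real.dist_eq] at h4
        have h5 := (abs_lt.1 h4).2
        have h6 := aux_stop_mono (yk k) hs
        simp only at h6
        have h7 := norm_sub_le (evalP (xk k) (min s (tk k))) (evalP (xk k) (min σ (tk k)))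
        have h8 := aux_norm_evalP hcT (xk k) (min s (tk k))
        have h9 := aux_norm_evalP hcT (xk k) (min σ (tk k))
        have h10 := aux_evalP_le_stopped hcT (yk k) (le_refl σ)
        have h11 : ‖evalP (yk k) s‖ ≤ ‖evalP (yk k) s - evalP (yk k) σ‖ + ‖evalP (yk k) σ‖ := by
          simpa using norm_add_le (evalP (yk k) s - evalP (yk k) σ) (evalP (yk k) σ)
        have h12 : (1 + ‖stopPath s (yk k)‖) * ∫ ξ in σ..s, cExt T (ck k) ξ ≤
            (1 + ‖stopPath τ (yk k)‖) * (1 / 2) := by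
          refine mul_le_mul (by linarith) (by linarith) ?_ (by positivity)
          exact intervalIntegral.integral_nonneg hsσ fun ξ _ => cExt_nonneg (hck k) ξ
        linarith
    linarith
  have hind : ∀ j : ℕ, ∃ R, ∀ᶠ k in atTop, ‖stopPath (min (j * (δ / 2)) T) (yk k)‖ ≤ R := by
    intro j
    induction j with
    | zero =>
      refine ⟨A, ?_⟩
      filter_upwards [hA] with k hk
      have hA0 : 0 ≤ A := (norm_nonneg _).trans hk.le
      obtain ⟨v, ⟨hst, -, -⟩, -⟩ := hyk k
      have h0 : min (((0:ℕ):ℝ) * (δ / 2)) T = 0 := by simp [hT.le]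
      rw [h0]
      refine aux_stop_le_of hcT _ hA0 (by linarith) fun s hs => ?_
      have h1 := aux_evalP_stopped hcT (by linarith [(htk k).1]) hst s
      rw [min_eq_left (hs.trans (htk k).1)] at h1
      simp only at h1
      rw [h1]
      exact (aux_norm_evalP hcT _ _).trans hk.le
    | succ j ih =>
      obtain ⟨R, hR⟩ := ih
      refine ⟨2 * R + (4 * A + 1), ?_⟩
      filter_upwards [hR, hA, hL4] with k h1 h2 h3
      have hj : (0:ℝ) ≤ j * (δ / 2) := by positivity
      have hj' : ((j + 1 : ℕ) : ℝ) * (δ / 2) = j * (δ / 2) + δ / 2 := by push_cast; ring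
      have := hstep k h2 h3 (min (j * (δ / 2)) T) ⟨le_min hj hT.le, min_le_right _ _⟩
        (min ((j + 1 : ℕ) * (δ / 2)) T) ⟨le_min (by positivity) hT.le, min_le_right _ _⟩
        (by rw [hj']; exact min_le_min_right _ (by linarith)) (by rw [hj']; grind)
      linarith
  obtain ⟨R, hRev⟩ : ∃ R, ∀ᶠ k in atTop, ‖yk k‖ ≤ R := by
    obtain ⟨j, hj⟩ := exists_nat_ge (T / (δ / 2))
    obtain ⟨R, hR⟩ := hind j
    refine ⟨R, ?_⟩
    filter_upwards [hR] with k hk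
    rw [min_eq_right ((div_le_iff₀ (by positivity)).1 hj)] at hk
    refine le_trans ?_ hk
    refine (ContinuousMap.norm_le _ (norm_nonneg _)).2 fun p => ?_
    have := aux_evalP_le_stopped hcT (yk k) p.2.2
    rwa [aux_evalP hcT, projIcc_val] at this
  obtain ⟨N, hN⟩ := eventually_atTop.1 hRev
  have hR0 : 0 ≤ R := (norm_nonneg _).trans (hN N le_rfl)
  -- equicontinuity
  have hmod : ∀ k, ‖yk k‖ ≤ R → ∀ σ τ, σ ≤ τ → τ ≤ T → ‖evalP (yk k) τ - evalP (yk k) σ‖ ≤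
      ‖evalP x (min τ (tk k)) - evalP x (min σ (tk k))‖ + 2 * ‖xk k - x‖ +
        (1 + R) * (C τ - C σ + L1dist T (ck k) c) := by
    intro k hk σ τ hστ hτ
    have h1 := aux_est hT hh (htk k) (hck k) (hyk k) hστ hτ
    have h2 := aux_int_bound (hck k) (yk k) hστ
    have h3 := hck' k σ τ hστ
    have h4 : (1 + ‖stopPath τ (yk k)‖) * ∫ ξ in σ..τ, cExt T (ck k) ξ ≤
        (1 + R) * (C τ - C σ + L1dist T (ck k) c) := by
      refine mul_le_mul (add_le_add le_rfl ((aux_stop_le _ _).trans hk)) h3 ?_ (by positivity)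
      exact intervalIntegral.integral_nonneg hστ fun ξ _ => cExt_nonneg (hck k) ξ
    have h5 : ‖evalP (xk k) (min τ (tk k)) - evalP (xk k) (min σ (tk k))‖ ≤
        ‖evalP x (min τ (tk k)) - evalP x (min σ (tk k))‖ + 2 * ‖xk k - x‖ := by
      have e : evalP (xk k) (min τ (tk k)) - evalP (xk k) (min σ (tk k)) =
          (evalP x (min τ (tk k)) - evalP x (min σ (tk k))) +
          (evalP (xk k - x) (min τ (tk k)) - evalP (xk k - x) (min σ (tk k))) := by
        rw [aux_evalP_sub hcT, aux_evalP_sub hcT]; abel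
      rw [e]
      refine (norm_add_le _ _).trans (by
        have := norm_sub_le (evalP (xk k - x) (min τ (tk k))) (evalP (xk k - x) (min σ (tk k)))
        linarith [aux_norm_evalP hcT (xk k - x) (min τ (tk k)),
          aux_norm_evalP hcT (xk k - x) (min σ (tk k))])
    linarith
  have hxuc : UniformContinuousOn (evalP x) (Icc (-h) T) :=
    isCompact_Icc.uniformContinuousOn_of_continuous (aux_evalP_cont hcT x).continuousOn
  obtain ⟨κ, hκ, y, hy⟩ := aux_arzela (fun k => yk (k + N)) R (fun k => hN _ (by omega)) (by
    intro p ε hε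
    obtain ⟨η, hη, hηx⟩ := Metric.uniformContinuousOn_iff.1 hxuc (ε / 4) (by positivity)
    have hCp : ∀ᶠ q : Icc (-h) T in 𝓝 p, dist (C q.1) (C p.1) < ε / (4 * (1 + R)) :=
      (hCcont.comp continuous_subtype_val).continuousAt.eventually
        (Metric.ball_mem_nhds _ (by positivity))
    refine ⟨_, inter_mem hCp (Metric.ball_mem_nhds p hη), ?_⟩
    have hx4 : ∀ᶠ k in atTop, ‖xk k - x‖ < ε / 8 :=
      (tendsto_iff_norm_sub_tendsto_zero.1 hxk).eventually (gt_mem_nhds (by positivity))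
    have hL5 : ∀ᶠ k in atTop, L1dist T (ck k) c < ε / (4 * (1 + R)) :=
      hL.eventually (gt_mem_nhds (by positivity))
    filter_upwards [(tendsto_add_atTop_nat N).eventually hx4,
      (tendsto_add_atTop_nat N).eventually hL5] with k h1 h2
    have main : ∀ a ∈ Icc (-h) T, ∀ b ∈ Icc (-h) T, a ≤ b → dist a b < η →
        C b - C a < ε / (4 * (1 + R)) → ‖evalP (yk (k + N)) b - evalP (yk (k + N)) a‖ < ε := by
      intro a ha b hb hab hd hCab
      have h3 := hmod (k + N) (hN _ (by omega)) a b hab hb.2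
      have ht0 := htk (k + N)
      have h4 := hηx (min b (tk (k + N))) ⟨le_min hb.1 (by linarith [ht0.1]), (min_le_left _ _).trans hb.2⟩
        (min a (tk (k + N))) ⟨le_min ha.1 (by linarith [ht0.1]), (min_le_left _ _).trans ha.2⟩ (by
          rw [dist_comm] at hd
          refine lt_of_le_of_lt ?_ hd
          rw [Real.dist_eq, Real.dist_eq]
          exact (abs_min_sub_min_le_max _ _ _ _).trans (by simp))
      rw [dist_eq_norm] at h4
      have h5 : (1 + R) * (C b - C a + L1dist T (ck (k + N)) c) < ε / 2 := by
        have : ε / 2 = (1 + R) * (ε / (4 * (1 + R)) + ε / (4 * (1 + R))) := by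
          field_simp; ring
        rw [this]
        exact mul_lt_mul_of_pos_left (by linarith) (by positivity)
      linarith
    rintro q ⟨hq1, hq2⟩
    have hq1' : dist (C q.1) (C p.1) < ε / (4 * (1 + R)) := hq1
    have hq2' : dist q.1 p.1 < η := hq2
    have ep : evalP (yk (k + N)) p.1 = yk (k + N) p := by rw [aux_evalP hcT, projIcc_val]
    have eq : evalP (yk (k + N)) q.1 = yk (k + N) q := by rw [aux_evalP hcT, projIcc_val]
    rw [← ep, ← eq]
    rw [Real.dist_eq] at hq1'
    rcases le_total p.1 q.1 with hpq | hpq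
    · rw [dist_comm, dist_eq_norm]
      exact main _ p.2 _ q.2 hpq (by rwa [dist_comm]) (abs_lt.1 hq1').2
    · rw [dist_eq_norm]
      exact main _ q.2 _ p.2 hpq hq2' (by linarith [(abs_lt.1 hq1').1]))
  have hκN : StrictMono fun i => κ i + N := fun i j hij => Nat.add_lt_add_right (hκ hij) N
  have hκt := hκN.tendsto_atTop
  refine ⟨fun i => κ i + N, hκN, y, ?_, tendsto_iff_norm_sub_tendsto_zero.1 hy⟩
  have hyn := tendsto_iff_norm_sub_tendsto_zero.1 hy
  have hxκ := hxk.comp hκt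
  have htκ := htk'.comp hκt
  have hLκ := hL.comp hκt
  have hyR : ∀ i, ‖yk (κ i + N)‖ ≤ R := fun i => hN _ (by omega)
  have hStopEq : stopPath t y = stopPath t x := by
    ext1 p
    have hval : ∀ z : PathSp n h T, stopPath t z p = evalP z (min p.1 t) := fun z =>
      aux_stop_eval hcT (by linarith [ht.1]) z p
    rw [hval, hval]
    have hm : Tendsto (fun i => min p.1 (tk (κ i + N))) atTop (𝓝 (min p.1 t)) :=
      tendsto_const_nhds.min htκ
    refine tendsto_nhds_unique (aux_evalP_tendsto hcT hy hm) ?_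
    refine (aux_evalP_tendsto hcT hxκ hm).congr fun i => ?_
    obtain ⟨v, ⟨hst, -, -⟩, -⟩ := hyk (κ i + N)
    exact (aux_evalP_stopped hcT (by linarith [(htk (κ i + N)).1]) hst p.1).symm
  have hfin : ∀ σ τ, t ≤ σ → σ ≤ τ → τ ≤ T → ‖evalP y τ - evalP y σ‖ ≤
      ∫ ξ in σ..τ, cExt T c ξ * (1 + ‖stopPath ξ y‖) := by
    intro σ τ hσ hστ hτ
    have l1 : Tendsto (fun i => ‖evalP (yk (κ i + N)) τ - evalP (yk (κ i + N)) σ‖) atTop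
        (𝓝 ‖evalP y τ - evalP y σ‖) :=
      ((aux_evalP_tendsto hcT hy tendsto_const_nhds).sub
        (aux_evalP_tendsto hcT hy tendsto_const_nhds)).norm
    have l2 : Tendsto (fun i => ‖evalP (xk (κ i + N)) (min τ (tk (κ i + N))) -
        evalP (xk (κ i + N)) (min σ (tk (κ i + N)))‖) atTop (𝓝 0) := by
      have := ((aux_evalP_tendsto hcT hxκ (tendsto_const_nhds (x := τ) |>.min htκ)).sub
        (aux_evalP_tendsto hcT hxκ (tendsto_const_nhds (x := σ) |>.min htκ))).norm
      rw [min_eq_right hσ, min_eq_right (hσ.trans hστ), sub_self, norm_zero] at this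
      exact this
    have l3 := (l2.add (((tendsto_const_nhds
      (x := ∫ ξ in σ..τ, cExt T c ξ * (1 + ‖stopPath ξ y‖))).add (hLκ.const_mul (1 + R))).add
        (hyn.mul_const (∫ ξ in σ..τ, cExt T c ξ))))
    simp only [mul_zero, zero_mul, add_zero, zero_add] at l3
    refine le_of_tendsto_of_tendsto' l1 l3 fun i => ?_
    refine (aux_est hT hh (htk _) (hck _) (hyk _) hστ hτ).trans (add_le_add le_rfl ?_)
    exact aux_int_conv hc (hck _) y (yk (κ i + N)) (hyR i) hστ
  obtain ⟨v, hv1, hv2, hv3⟩ := aux_ac_deriv ht.2 (evalP y) _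
    (cExt_mul_int hc y).intervalIntegrable hfin
  refine ⟨v, ⟨hStopEq, hv1, hv2⟩, ?_⟩
  filter_upwards [hv3, ae_restrict_mem measurableSet_Icc] with ξ h1 h2
  have : ξ ∈ Icc 0 T := ⟨ht.1.trans h2.1, h2.2⟩
  simpa [cExt, this] using h1

end
end

section
/- For every (t, x(·)) ∈ [0,T] × C and every nonnegative function c(·) ∈ L¹([0,T],ℝ), the set Y(t, x(·); c(·)) is a nonempty compact subset of C. -/
open MeasureTheory Set Filter Topology

noncomputable section

attribute [local instance] Classical.propDecidable

lemma aux_deriv {n : ℕ} {t T : ℝ} (htT : t ≤ T) (u : ℝ → Euc n) (g : ℝ → ℝ)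
    (hg : Integrable g)
    (hinc : ∀ a b, t ≤ a → a ≤ b → b ≤ T → ‖u b - u a‖ ≤ ∫ s in a..b, g s) :
    ∃ u' : ℝ → Euc n, IntervalIntegrable u' volume t T ∧
      (∀ τ ∈ Set.Icc t T, u τ = u t + ∫ ξ in t..τ, u' ξ) ∧
      ∀ᵐ τ ∂(volume.restrict (Set.Icc t T)), ‖u' τ‖ ≤ g τ := by
  have hgi : ∀ a b, IntervalIntegrable g volume a b := fun a b => hg.intervalIntegrable
  have hsub : ∀ a b, (∫ s in a..b, g s) = (∫ s in t..b, g s) - ∫ s in t..a, g s := fun a b =>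
    (intervalIntegral.integral_interval_sub_left (hgi _ _) (hgi _ _)).symm
  have hdist : ∀ i : Fin n, ∀ a ∈ Set.Icc t T, ∀ b ∈ Set.Icc t T,
      dist (u a i) (u b i) ≤ dist (∫ s in t..a, g s) (∫ s in t..b, g s) := by
    intro i a ha b hb
    wlog hab : a ≤ b generalizing a b
    · rw [dist_comm, dist_comm (∫ s in t..a, g s)]
      exact this b hb a ha (le_of_not_ge hab)
    have h1 := hinc a b ha.1 hab hb.2
    have h2 : ‖(u b - u a) i‖ ≤ ‖u b - u a‖ := PiLp.norm_apply_le _ i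
    rw [dist_comm, dist_comm (∫ s in t..a, g s), Real.dist_eq (∫ s in t..b, g s), ← hsub, dist_eq_norm]
    exact h2.trans (h1.trans (le_abs_self _))
  have hF : AbsolutelyContinuousOnInterval (fun x => ∫ v in t..x, g v) t T :=
    (hgi t T).absolutelyContinuousOnInterval_intervalIntegral (by simp)
  have hAC : ∀ i : Fin n, AbsolutelyContinuousOnInterval (fun s => u s i) t T := by
    intro i
    unfold AbsolutelyContinuousOnInterval at hF ⊢
    refine squeeze_zero' (Eventually.of_forall fun E => Finset.sum_nonneg fun _ _ => dist_nonneg) ?_ hF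
    refine Eventually.filter_mono inf_le_right ?_
    rw [eventually_principal]
    intro E hE
    refine Finset.sum_le_sum fun k hk => ?_
    have := hE.1 k hk
    rw [uIcc_of_le htT] at this
    exact hdist i _ this.1 _ this.2
  have hint : ∀ i : Fin n, IntervalIntegrable (deriv (fun s => u s i)) volume t T :=
    fun i => (hAC i).intervalIntegrable_deriv
  refine ⟨fun s => WithLp.toLp 2 (fun i => deriv (fun s => u s i) s), ?_, ?_, ?_⟩
  · rw [intervalIntegrable_iff]
    refine Integrable.of_eval_piLp fun i => ?_
    exact intervalIntegrable_iff.1 (hint i)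
  · intro τ hτ
    ext i
    have h1 := ((hAC i).mono (c := t) (d := τ) (by
      rw [uIcc_of_le htT, uIcc_of_le hτ.1]; exact Icc_subset_Icc_right hτ.2))
    have h2 := h1.integral_deriv_eq_sub
    have h3 : ∀ j : Fin n, IntervalIntegrable (deriv (fun s => u s j)) volume t τ := fun j =>
      (hint j).mono_set (by
        rw [uIcc_of_le htT, uIcc_of_le hτ.1]; exact Icc_subset_Icc_right hτ.2)
    rw [PiLp.add_apply, intervalIntegral.integral_of_le hτ.1, eval_integral_piLp]
    · rw [intervalIntegral.integral_of_le hτ.1] at h2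
      simp only [h2]
      ring
    · intro j
      have := intervalIntegrable_iff.1 (h3 j)
      rw [uIoc_of_le hτ.1] at this
      exact this
  · rw [ae_restrict_iff' measurableSet_Icc]
    have hall : ∀ᵐ x : ℝ, ∀ i : Fin n, x ∈ uIcc t T → DifferentiableAt ℝ (fun s => u s i) x :=
      ae_all_iff.2 fun i => (hAC i).ae_differentiableAt
    have hT' : ∀ᵐ x : ℝ, x ≠ T := by simp [ae_iff, measure_singleton]
    filter_upwards [hall, hT', _root_.LocallyIntegrable.ae_hasDerivAt_integral hg.locallyIntegrable] with x hx hxT hxg hxI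
    have hxlt : x < T := lt_of_le_of_ne hxI.2 hxT
    rw [uIcc_of_le htT] at hx
    have hd : HasDerivAt u (WithLp.toLp 2 (fun i => deriv (fun s => u s i) x)) x := by
      have h1 : HasDerivAt (fun s => WithLp.ofLp (u s)) (fun i => deriv (fun s => u s i) x) x :=
        hasDerivAt_pi.2 fun i => (hx i hxI).hasDerivAt
      exact ((PiLp.continuousLinearEquiv 2 ℝ (fun _ : Fin n => ℝ)).symm : (Fin n → ℝ) →L[ℝ] Euc n).hasFDerivAt.comp_hasDerivAt x h1
    have hs1 := (hasDerivAt_iff_tendsto_slope.1 hd).mono_left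
      (nhdsWithin_mono x (s := Ioi x) (fun y (hy : x < y) => ne_of_gt hy))
    have hs2 := (hasDerivAt_iff_tendsto_slope.1 (hxg t)).mono_left
      (nhdsWithin_mono x (s := Ioi x) (fun y (hy : x < y) => ne_of_gt hy))
    refine le_of_tendsto_of_tendsto hs1.norm hs2 ?_
    filter_upwards [Ioo_mem_nhdsGT hxlt] with b hb
    rw [slope_def_module, slope_def_module, norm_smul, smul_eq_mul, ← hsub, Real.norm_eq_abs,
      abs_of_nonneg (inv_nonneg.2 (sub_nonneg.2 hb.1.le))]
    exact mul_le_mul_of_nonneg_left (hinc x b hxI.1 hb.1.le hb.2.le)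
      (inv_nonneg.2 (sub_nonneg.2 hb.1.le))

lemma stopPath_apply {n : ℕ} {h T : ℝ} (t : ℝ) (y : PathSp n h T) (s) :
    stopPath t y s = y (stopTime h T t s) := rfl

lemma norm_stopPath_le {n : ℕ} {h T : ℝ} (t : ℝ) (y : PathSp n h T) :
    ‖stopPath t y‖ ≤ ‖y‖ :=
  (ContinuousMap.norm_le _ (norm_nonneg _)).2 fun s => by
    rw [stopPath_apply]; exact y.norm_coe_le_norm _

lemma stopPath_stopPath {n : ℕ} {h T : ℝ} {a b : ℝ} (hab : a ≤ b) (y : PathSp n h T) :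
    stopPath a (stopPath b y) = stopPath a y := by
  ext1 s
  simp only [stopPath_apply]
  congr 1
  ext
  have := s.2.1
  simp only [stopTime]
  grind

lemma norm_stopPath_mono {n : ℕ} {h T : ℝ} (y : PathSp n h T) :
    Monotone fun a => ‖stopPath a y‖ := by
  intro a b hab
  simp only
  rw [← stopPath_stopPath hab]
  exact norm_stopPath_le _ _

lemma evalP_eq {n : ℕ} {h T : ℝ} (y : PathSp n h T) {τ : ℝ} (hτ : τ ∈ Icc (-h) T) :
    evalP y τ = y ⟨τ, hτ⟩ := by
  unfold evalP
  rw [dif_pos (hτ.1.trans hτ.2), projIcc_of_mem _ hτ]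

lemma continuous_evalP {n : ℕ} {h T : ℝ} (τ : ℝ) :
    Continuous fun y : PathSp n h T => evalP y τ := by
  unfold evalP
  split_ifs
  · exact continuous_eval_const _
  · exact continuous_const

lemma continuous_stopPath {n : ℕ} {h T : ℝ} (τ : ℝ) :
    Continuous fun y : PathSp n h T => stopPath τ y :=
  ContinuousMap.continuous_precomp _

lemma integrable_cm {n : ℕ} {h T : ℝ} (y : PathSp n h T) {g : ℝ → ℝ} (hg : Integrable g) :
    Integrable fun τ => g τ * (1 + ‖stopPath τ y‖) := by
  refine hg.mul_bdd (c := 1 + ‖y‖) ?_ ?_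
  · exact ((norm_stopPath_mono y).measurable.const_add 1).aestronglyMeasurable
  · refine Eventually.of_forall fun τ => ?_
    rw [Real.norm_eq_abs, abs_of_nonneg (by positivity)]
    linarith [norm_stopPath_le τ y]

lemma continuous_int {n : ℕ} {h T : ℝ} {g : ℝ → ℝ} (hg : Integrable g) (a b : ℝ) :
    Continuous fun y : PathSp n h T => ∫ τ in a..b, g τ * (1 + ‖stopPath τ y‖) := by
  refine continuous_iff_continuousAt.2 fun y₀ => ?_
  refine intervalIntegral.continuousAt_of_dominated_interval
    (bound := fun τ => |g τ| * (1 + (‖y₀‖ + 1))) ?_ ?_ ?_ ?_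
  · exact Eventually.of_forall fun y => (integrable_cm y hg).aestronglyMeasurable.restrict
  · have : ∀ᶠ y : PathSp n h T in 𝓝 y₀, ‖y‖ < ‖y₀‖ + 1 :=
      continuous_norm.continuousAt.eventually_lt continuousAt_const (by simp)
    filter_upwards [this] with y hy
    refine Eventually.of_forall fun τ _ => ?_
    rw [norm_mul, Real.norm_eq_abs, Real.norm_eq_abs, abs_of_nonneg (a := 1 + ‖stopPath τ y‖) (by positivity)]
    gcongr
    exact (norm_stopPath_le τ y).trans hy.le
  · exact (hg.abs.mul_const _).intervalIntegrable
  · refine Eventually.of_forall fun τ _ => Continuous.continuousAt ?_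
    exact continuous_const.mul (continuous_const.add (continuous_stopPath τ).norm)

/-- Integral form of membership in `YSet`. -/
def Inc {n : ℕ} {h T : ℝ} (t : ℝ) (g : ℝ → ℝ) (y : PathSp n h T) : Prop :=
  ∀ a b, t ≤ a → a ≤ b → b ≤ T →
    ‖evalP y b - evalP y a‖ ≤ ∫ τ in a..b, g τ * (1 + ‖stopPath τ y‖)

lemma mem_YSet_iff {n : ℕ} {h T : ℝ} {t : ℝ} (htT : t ≤ T) (x : PathSp n h T)
    {c : ℝ → ℝ} (hc : IntegrableOn c (Icc t T)) (y : PathSp n h T) :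
    y ∈ YSet t x c ↔ stopPath t y = stopPath t x ∧ Inc t ((Icc t T).indicator c) y := by
  have hg : Integrable ((Icc t T).indicator c) :=
    (integrable_indicator_iff measurableSet_Icc).2 hc
  have hcm := integrable_cm y hg
  constructor
  · rintro ⟨y', ⟨h1, h2, h3⟩, h4⟩
    simp only at h1 h2 h3 h4
    refine ⟨h1, fun a b hta hab hbT => ?_⟩
    have hi : ∀ s ∈ Icc t T, IntervalIntegrable y' volume t s := fun s hs =>
      h2.mono_set (by rw [uIcc_of_le htT, uIcc_of_le hs.1]; exact Icc_subset_Icc_right hs.2)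
    have ha : a ∈ Icc t T := ⟨hta, hab.trans hbT⟩
    have hb : b ∈ Icc t T := ⟨hta.trans hab, hbT⟩
    rw [h3 b hb, h3 a ha, add_sub_add_left_eq_sub,
      intervalIntegral.integral_interval_sub_left (hi b hb) (hi a ha)]
    refine intervalIntegral.norm_integral_le_of_norm_le hab ?_ hcm.intervalIntegrable
    rw [ae_restrict_iff' measurableSet_Icc] at h4
    filter_upwards [h4] with s hs hs'
    have hsI : s ∈ Icc t T := ⟨hta.trans hs'.1.le, hs'.2.trans hbT⟩
    rw [indicator_of_mem hsI]
    exact hs hsI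
  · rintro ⟨h1, h2⟩
    obtain ⟨u', h3, h4, h5⟩ := aux_deriv htT (evalP y) _ hcm h2
    refine ⟨u', ⟨h1, h3, h4⟩, ?_⟩
    rw [ae_restrict_iff' measurableSet_Icc] at h5 ⊢
    filter_upwards [h5] with s hs hs'
    have := hs hs'
    rwa [indicator_of_mem hs'] at this

lemma inc_step {n : ℕ} {h T : ℝ} {t : ℝ} (hht : -h ≤ t) {g : ℝ → ℝ} (hg : Integrable g)
    (hg0 : ∀ s, 0 ≤ g s) {y : PathSp n h T} (hy : Inc t g y) {a b : ℝ} (hta : t ≤ a)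
    (hab : a ≤ b) (hbT : b ≤ T) :
    (∫ τ in a..b, g τ * (1 + ‖stopPath τ y‖)) ≤ (1 + ‖stopPath b y‖) * ∫ τ in a..b, g τ := by
  rw [← intervalIntegral.integral_const_mul]
  refine intervalIntegral.integral_mono_on hab (integrable_cm y hg).intervalIntegrable
    (hg.const_mul _).intervalIntegrable fun s hs => ?_
  rw [mul_comm]
  exact mul_le_mul_of_nonneg_right (add_le_add le_rfl (norm_stopPath_mono y hs.2)) (hg0 s)

lemma inc_growth {n : ℕ} {h T : ℝ} {t : ℝ} (hht : -h ≤ t) {g : ℝ → ℝ} (hg : Integrable g)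
    (hg0 : ∀ s, 0 ≤ g s) {y : PathSp n h T} (hy : Inc t g y) {a b : ℝ} (hta : t ≤ a)
    (hab : a ≤ b) (hbT : b ≤ T) :
    1 + ‖stopPath b y‖ ≤ 1 + ‖stopPath a y‖ + (1 + ‖stopPath b y‖) * ∫ τ in a..b, g τ := by
  have hI : 0 ≤ ∫ τ in a..b, g τ := intervalIntegral.integral_nonneg hab fun s _ => hg0 s
  rw [add_assoc]
  refine add_le_add le_rfl ((ContinuousMap.norm_le _ (by positivity)).2 fun s => ?_)
  have hP : 0 ≤ (1 + ‖stopPath b y‖) * ∫ τ in a..b, g τ := by positivity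
  have haI : a ∈ Icc (-h) T := ⟨hht.trans hta, hab.trans hbT⟩
  have hya : ‖evalP y a‖ ≤ ‖stopPath a y‖ := by
    have := (stopPath a y).norm_coe_le_norm ⟨a, haI⟩
    have h1 : stopPath a y ⟨a, haI⟩ = evalP y a := by
      rw [evalP_eq y haI, stopPath_apply]
      congr 1
      ext
      simp [stopTime, haI.1]
    rwa [h1] at this
  rcases le_total s.1 a with hsa | has
  · have h1 := (stopPath a y).norm_coe_le_norm s
    have h2 : stopPath b y s = stopPath a y s := by
      simp only [stopPath_apply]
      congr 1
      ext
      simp only [stopTime]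
      grind
    rw [h2]
    linarith
  · set r := min s.1 b with hr
    have har : a ≤ r := le_min has hab
    have hrb : r ≤ b := min_le_right _ _
    have hrI : r ∈ Icc (-h) T := ⟨haI.1.trans har, hrb.trans hbT⟩
    have h1 : stopPath b y s = evalP y r := by
      rw [evalP_eq y hrI, stopPath_apply]
      congr 1
      ext
      simp [stopTime, ← hr, hrI.1]
    have h2 := hy a r hta har (hrb.trans hbT)
    have h3 := inc_step hht hg hg0 hy hta har (hrb.trans hbT)
    have h4 : (∫ τ in a..r, g τ) ≤ ∫ τ in a..b, g τ :=
      intervalIntegral.integral_mono_interval le_rfl har hrb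
        (Eventually.of_forall hg0) hg.intervalIntegrable
    have h5 : 1 + ‖stopPath r y‖ ≤ 1 + ‖stopPath b y‖ :=
      add_le_add le_rfl (norm_stopPath_mono y hrb)
    have h6 : (1 + ‖stopPath r y‖) * ∫ τ in a..r, g τ ≤ (1 + ‖stopPath b y‖) * ∫ τ in a..b, g τ :=
      mul_le_mul h5 h4 (intervalIntegral.integral_nonneg har fun s _ => hg0 s) (by positivity)
    rw [h1]
    have h7 : ‖evalP y r‖ ≤ ‖evalP y a‖ + ‖evalP y r - evalP y a‖ := by
      have := norm_add_le (evalP y a) (evalP y r - evalP y a)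
      rwa [add_sub_cancel] at this
    linarith

lemma inc_bound {n : ℕ} {h T : ℝ} {t : ℝ} (hht : -h ≤ t) (htT : t ≤ T) {g : ℝ → ℝ}
    (hg : Integrable g) (hg0 : ∀ s, 0 ≤ g s) :
    ∃ K : ℝ, 0 ≤ K ∧ ∀ y : PathSp n h T, Inc t g y → 1 + ‖y‖ ≤ K * (1 + ‖stopPath t y‖) := by
  have hcont : Continuous fun b => ∫ s in t..b, g s :=
    intervalIntegral.continuous_primitive (fun _ _ => hg.intervalIntegrable) t
  have huc := isCompact_Icc.uniformContinuousOn_of_continuous (s := Icc t T) hcont.continuousOn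
  obtain ⟨δ, hδ, hδ'⟩ := Metric.uniformContinuousOn_iff.1 huc (1/2) (by norm_num)
  obtain ⟨N, hN⟩ := exists_nat_gt ((T - t) / (δ / 2))
  have key : ∀ y : PathSp n h T, Inc t g y → ∀ k : ℕ,
      1 + ‖stopPath (min (t + k * (δ/2)) T) y‖ ≤ 2 ^ k * (1 + ‖stopPath t y‖) := by
    intro y hy k
    induction k with
    | zero => simp [htT]
    | succ k ih =>
      set a := min (t + k * (δ/2)) T with ha
      set b := min (t + (k + 1 : ℕ) * (δ/2)) T with hb
      have hk : (0:ℝ) ≤ k * (δ / 2) := by positivity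
      have hta : t ≤ a := le_min (by linarith) htT
      have hab : a ≤ b := min_le_min (by push_cast; linarith) le_rfl
      have hbT : b ≤ T := min_le_right _ _
      have hba : b - a < δ := by
        have h1 : b ≤ t + (k + 1 : ℕ) * (δ/2) := min_le_left _ _
        push_cast at h1
        rcases min_choice (t + k * (δ/2)) T with h2 | h2
        · rw [ha, h2]; linarith
        · rw [ha, h2]; linarith
      have h1 := hδ' b ⟨hta.trans hab, hbT⟩ a ⟨hta, hab.trans hbT⟩ (by
        rw [Real.dist_eq, abs_of_nonneg (by linarith)]; exact hba)
      rw [Real.dist_eq, intervalIntegral.integral_interval_sub_left hg.intervalIntegrable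
        hg.intervalIntegrable] at h1
      have h2 := (abs_lt.1 h1).2
      have h3 := inc_growth hht hg hg0 hy hta hab hbT
      have h4 : (1 + ‖stopPath b y‖) * ∫ τ in a..b, g τ ≤ (1 + ‖stopPath b y‖) * (1/2) :=
        mul_le_mul_of_nonneg_left h2.le (by positivity)
      rw [pow_succ]
      nlinarith
  refine ⟨2 ^ N, by positivity, fun y hy => ?_⟩
  have h1 := key y hy N
  have h2 : min (t + N * (δ/2)) T = T := by
    rw [div_lt_iff₀ (by positivity)] at hN
    exact min_eq_right (by linarith)
  rw [h2] at h1
  have h3 : stopPath T y = y := by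
    ext1 s
    rw [stopPath_apply]
    congr 1
    ext
    simp [stopTime, s.2.1, s.2.2]
  rwa [h3] at h1

/-- for every `(t,x(·)) ∈ [0,T] × C` and every nonnegative
`c(·) ∈ L¹([0,T],ℝ)`, the set `Y(t,x(·);c(·))` is a nonempty compact subset of `C`. -/
theorem stmt1 {n : ℕ} {h T : ℝ} (hT : 0 < T) (hh : 0 ≤ h)
    (t : ℝ) (ht : t ∈ Set.Icc (0:ℝ) T) (x : PathSp n h T)
    (c : ℝ → ℝ) (hc : IntegNonneg T c) :
    (YSet t x c).Nonempty ∧ IsCompact (YSet t x c) := by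
  have htT := ht.2
  have hht : -h ≤ t := by linarith [ht.1]
  have htI : t ∈ Icc (-h) T := ⟨hht, htT⟩
  have hsub : Icc t T ⊆ Icc 0 T := Icc_subset_Icc_left ht.1
  have hci : IntegrableOn c (Icc t T) := hc.1.mono_set hsub
  have hc0 : ∀ τ ∈ Icc t T, 0 ≤ c τ := fun τ hτ => hc.2 τ (hsub hτ)
  constructor
  · refine ⟨stopPath t x, fun _ => 0, ⟨stopPath_stopPath le_rfl x, by simp, ?_⟩, ?_⟩
    · intro τ hτ
      have hτI : τ ∈ Icc (-h) T := ⟨hht.trans hτ.1, hτ.2⟩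
      simp only [intervalIntegral.integral_zero, add_zero]
      rw [evalP_eq _ hτI, evalP_eq _ htI, stopPath_apply, stopPath_apply]
      congr 1
      ext
      simp [stopTime, hτ.1]
    · rw [ae_restrict_iff' measurableSet_Icc]
      refine Eventually.of_forall fun τ hτ => ?_
      have := hc0 τ hτ
      simp only [norm_zero]
      positivity
  set g := (Icc t T).indicator c with hgdef
  have hg : Integrable g := (integrable_indicator_iff measurableSet_Icc).2 hci
  have hg0 : ∀ s, 0 ≤ g s := fun s => indicator_nonneg hc0 s
  have hY : YSet t x c = {y | stopPath t y = stopPath t x} ∩ {y | Inc t g y} := by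
    ext y
    exact mem_YSet_iff htT x hci y
  have hclosed : IsClosed (YSet t x c) := by
    rw [hY]
    refine (isClosed_eq (continuous_stopPath t) continuous_const).inter ?_
    simp only [Inc, ofPred_forall]
    refine isClosed_iInter fun a => isClosed_iInter fun b => isClosed_iInter fun _ =>
      isClosed_iInter fun _ => isClosed_iInter fun _ => ?_
    exact isClosed_le ((continuous_evalP b).sub (continuous_evalP a)).norm (continuous_int hg a b)
  obtain ⟨K, hK0, hK⟩ := inc_bound (n := n) (h := h) hht htT hg hg0
  set M := K * (1 + ‖stopPath t x‖) with hM
  have hbd : ∀ y ∈ YSet t x c, 1 + ‖y‖ ≤ M := by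
    intro y hy
    rw [hY] at hy
    have := hK y hy.2
    rwa [hy.1] at this
  set G : ℝ → ℝ := fun b => ∫ s in t..b, g s with hG
  have hGc : Continuous G :=
    intervalIntegral.continuous_primitive (fun _ _ => hg.intervalIntegrable) t
  have hincG : ∀ y ∈ YSet t x c, ∀ a ∈ Icc t T, ∀ b ∈ Icc t T,
      dist (evalP y a) (evalP y b) ≤ M * |G a - G b| := by
    intro y hy a ha b hb
    wlog hab : a ≤ b generalizing a b
    · rw [dist_comm, abs_sub_comm]
      exact this b hb a ha (le_of_not_ge hab)
    have hy' := hy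
    rw [hY] at hy'
    have h1 := hy'.2 a b ha.1 hab hb.2
    have h2 := inc_step hht hg hg0 hy'.2 ha.1 hab hb.2
    have h3 : 1 + ‖stopPath b y‖ ≤ M := by linarith [norm_stopPath_le b y, hbd y hy]
    have hI : 0 ≤ ∫ τ in a..b, g τ := intervalIntegral.integral_nonneg hab fun s _ => hg0 s
    have h4 : G b - G a = ∫ τ in a..b, g τ :=
      intervalIntegral.integral_interval_sub_left hg.intervalIntegrable hg.intervalIntegrable
    rw [dist_comm, dist_eq_norm, abs_sub_comm, h4, abs_of_nonneg hI]
    exact h1.trans (h2.trans (mul_le_mul_of_nonneg_right h3 hI))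
  have hdec : ∀ y ∈ YSet t x c, ∀ s : Icc (-h) T,
      y s = stopPath t x s + (evalP y (max s.1 t) - evalP y t) := by
    intro y hy s
    rw [hY] at hy
    have h1 : stopPath t y = stopPath t x := hy.1
    rw [← h1]
    rcases le_total s.1 t with hs | hs
    · rw [max_eq_right hs, sub_self, add_zero, stopPath_apply]
      congr 1
      ext
      simp [stopTime, hs, s.2.1]
    · rw [max_eq_left hs, evalP_eq y s.2, evalP_eq y htI]
      have : stopPath t y s = y ⟨t, htI⟩ := by
        rw [stopPath_apply]
        congr 1
        ext
        simp [stopTime, hs, hht]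
      rw [this]
      simp
  let e := ContinuousMap.isometryEquivBoundedOfCompact (Icc (-h) T) (Euc n)
  have hcomp : IsCompact (e.symm ⁻¹' (YSet t x c)) := by
    refine BoundedContinuousFunction.arzela_ascoli₂ (Metric.closedBall 0 M)
      (isCompact_closedBall _ _) _ (hclosed.preimage e.symm.continuous) ?_ ?_
    · intro f s hf
      have h1 := hbd _ hf
      have h2 := (e.symm f).norm_coe_le_norm s
      rw [mem_closedBall_zero_iff]
      change ‖(e.symm f) s‖ ≤ M
      linarith
    · intro s₀
      refine Metric.equicontinuousAt_of_continuity_modulus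
        (fun s => dist (stopPath t x s₀) (stopPath t x s) +
          M * |G (max s₀.1 t) - G (max s.1 t)|) ?_ _ ?_
      · have : Continuous (fun s : Icc (-h) T => dist (stopPath t x s₀) (stopPath t x s) +
          M * |G (max s₀.1 t) - G (max s.1 t)|) := by
          have h1 : Continuous fun s : Icc (-h) T => G (max s.1 t) :=
            hGc.comp (continuous_subtype_val.max continuous_const)
          have h2 := (stopPath t x).continuous
          fun_prop
        have := this.tendsto s₀
        simpa using this
      · refine Eventually.of_forall fun s f => ?_
        have hf := f.2
        have hmax : ∀ s : Icc (-h) T, max s.1 t ∈ Icc t T := fun s =>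
          ⟨le_max_right _ _, max_le s.2.2 htT⟩
        change dist ((e.symm f.1) s₀) ((e.symm f.1) s) ≤ _
        rw [hdec _ hf s₀, hdec _ hf s]
        refine (dist_add_add_le _ _ _ _).trans (add_le_add le_rfl ?_)
        rw [dist_sub_right]
        exact hincG _ hf _ (hmax _) _ (hmax _)
  have := hcomp.image e.symm.continuous
  rwa [image_preimage_eq _ e.symm.surjective] at this

end
end

section
/- Suppose H : [0,T] × C × ℝⁿ → ℝ satisfies conditions (A.1)–(A.5). Then, for every compact set D ⊂ C, there exists a set E_H ⊂ [0,T] with μ(E_H) = T such that H(t, x(·), s) = H(t, x(·∧t), s) for all t ∈ E_H, x(·) ∈ D, s ∈ ℝⁿ (the non-anticipation property of the Hamiltonian). -/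
open MeasureTheory Set Filter Topology

noncomputable section

attribute [local instance] Classical.propDecidable

/-- non-anticipation of the Hamiltonian: for every compact `D`
there is a full-measure set on which `H(t,x(·),s) = H(t,x(·∧t),s)`. -/
theorem stmt4 {n : ℕ} {h T : ℝ} (hT : 0 < T) (hh : 0 ≤ h)
    (H : ℝ → PathSp n h T → Euc n → ℝ) (cH : ℝ → ℝ) (hH : CondA H cH)
    (D : Set (PathSp n h T)) (hD : IsCompact D) :
    ∃ E : Set ℝ, E ⊆ Set.Icc 0 T ∧ volume E = ENNReal.ofReal T ∧
      ∀ t ∈ E, ∀ x ∈ D, ∀ s : Euc n, H t x s = H t (stopPath t x) s := by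
  obtain ⟨h1, ⟨E2, hE2s, hE2v, hE2c⟩, h3, -, -⟩ := hH
  have hcm : Continuous (fun t : ℝ =>
      (⟨stopTime h T t, continuous_stopTime h T t⟩ :
        ContinuousMap (Set.Icc (-h) T) (Set.Icc (-h) T))) := by
    apply ContinuousMap.continuous_of_continuous_uncurry
    refine Continuous.subtype_mk ?_ _
    exact continuous_const.max ((continuous_subtype_val.comp continuous_snd).min continuous_fst)
  have hsp : Continuous (fun p : ℝ × PathSp n h T => stopPath p.1 p.2) :=
    Continuous.compCM continuous_snd (hcm.comp continuous_fst)
  have hspx : ∀ t : ℝ, Continuous (fun x : PathSp n h T => stopPath t x) := fun t =>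
    hsp.comp (Continuous.prodMk continuous_const continuous_id)
  have hspt : ∀ x : PathSp n h T, Continuous (fun t : ℝ => stopPath t x) := fun x =>
    hsp.comp (Continuous.prodMk continuous_id continuous_const)
  have hidem : ∀ t ∈ Set.Icc (0:ℝ) T, ∀ x : PathSp n h T,
      stopPath t (stopPath t x) = stopPath t x := by
    intro t ht x
    ext1 τ
    change x (stopTime h T t (stopTime h T t τ)) = x (stopTime h T t τ)
    congr 1
    apply Subtype.ext
    change max (-h) (min (max (-h) (min τ.1 t)) t) = max (-h) (min τ.1 t)
    have : max (-h) (min τ.1 t) ≤ t := max_le (by linarith [ht.1]) (min_le_right _ _)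
    rw [min_eq_left this, max_eq_right (le_max_left _ _)]
  have hTid : ∀ x : PathSp n h T, stopPath T x = x := by
    intro x
    ext1 τ
    change x (stopTime h T T τ) = x τ
    congr 1
    apply Subtype.ext
    change max (-h) (min τ.1 T) = τ.1
    rw [min_eq_left τ.2.2, max_eq_right τ.2.1]
  set D' : Set (PathSp n h T) :=
    (fun p : ℝ × PathSp n h T => stopPath p.1 p.2) '' (Set.Icc (0:ℝ) T ×ˢ D) with hD'
  have hD'c : IsCompact D' := (isCompact_Icc.prod hD).image hsp
  have hDD' : ∀ x ∈ D, x ∈ D' := fun x hx =>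
    ⟨(T, x), ⟨⟨hT.le, le_refl T⟩, hx⟩, hTid x⟩
  obtain ⟨lam, ⟨hlam, -⟩, h3⟩ := h3 D' hD'c
  haveI : CompactSpace D' := isCompact_iff_compactSpace.mp hD'c
  obtain ⟨S, hSc, hSd⟩ := TopologicalSpace.exists_countable_dense (D' × D' × Euc n)
  have hvol : volume.restrict (Set.Icc (0:ℝ) T) Set.univ = ENNReal.ofReal T := by
    simp
  have hae : ∀ z : D' × D' × Euc n, ∀ᵐ t ∂(volume.restrict (Set.Icc (0:ℝ) T)),
      |H t z.1 z.2.2 - H t z.2.1 z.2.2| ≤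
        lam t * (1 + ‖z.2.2‖) * ‖stopPath t (z.1 : PathSp n h T) - stopPath t z.2.1‖ := by
    rintro ⟨x₁, x₂, s⟩
    obtain ⟨E, hEs, hEv, hE⟩ := h3 x₁ x₁.2 x₂ x₂.2 s
    have hm : ∀ x : PathSp n h T,
        AEMeasurable (fun t => H t x s) (volume.restrict (Set.Icc (0:ℝ) T)) := fun x =>
      aemeasurable_restrict_of_measurable_subtype measurableSet_Icc (h1 x s)
    have hf : AEMeasurable (fun t => |H t x₁ s - H t x₂ s|)
        (volume.restrict (Set.Icc (0:ℝ) T)) :=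
      continuous_abs.measurable.comp_aemeasurable ((hm x₁).sub (hm x₂))
    have hg : AEMeasurable (fun t => lam t * (1 + ‖s‖) *
        ‖stopPath t (x₁ : PathSp n h T) - stopPath t (x₂ : PathSp n h T)‖)
        (volume.restrict (Set.Icc (0:ℝ) T)) :=
      (hlam.aestronglyMeasurable.aemeasurable.mul_const _).mul
        (((hspt x₁).sub (hspt x₂)).norm.measurable.aemeasurable)
    rw [ae_iff_measure_eq (nullMeasurableSet_le hf hg)]
    apply le_antisymm (measure_mono (Set.subset_univ _))
    rw [hvol, ← hEv]
    calc volume E = volume.restrict (Set.Icc (0:ℝ) T) E := by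
          rw [Measure.restrict_apply' measurableSet_Icc, Set.inter_eq_left.mpr hEs]
      _ ≤ _ := measure_mono hE
  have haeS := (ae_ball_iff hSc).mpr (fun z (_ : z ∈ S) => hae z)
  set G : Set ℝ := {t | ∀ z ∈ S, |H t z.1 z.2.2 - H t z.2.1 z.2.2| ≤
        lam t * (1 + ‖z.2.2‖) * ‖stopPath t (z.1 : PathSp n h T) - stopPath t z.2.1‖} with hG
  refine ⟨E2 ∩ G, fun t ht => hE2s ht.1, ?_, ?_⟩
  · rw [← hE2v]
    have e1 : ∀ A : Set ℝ, A ⊆ Set.Icc 0 T →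
        volume A = volume.restrict (Set.Icc (0:ℝ) T) A := fun A hA => by
      rw [Measure.restrict_apply' measurableSet_Icc, Set.inter_eq_left.mpr hA]
    rw [e1 _ hE2s, e1 _ (fun t ht => hE2s ht.1)]
    apply measure_congr
    filter_upwards [haeS] with t ht
    have : t ∈ G := ht
    exact propext ⟨fun a => a.1, fun a => ⟨a, this⟩⟩
  · rintro t ⟨ht2, htG⟩ x hx s
    have hc := hE2c t ht2
    have hcl : IsClosed {z : D' × D' × Euc n | |H t z.1 z.2.2 - H t z.2.1 z.2.2| ≤
        lam t * (1 + ‖z.2.2‖) * ‖stopPath t (z.1 : PathSp n h T) - stopPath t z.2.1‖} := by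
      have c1 : Continuous (fun z : D' × D' × Euc n => H t z.1 z.2.2) :=
        hc.comp (f := fun z : D' × D' × Euc n => ((z.1 : PathSp n h T), z.2.2)) (by fun_prop)
      have c2 : Continuous (fun z : D' × D' × Euc n => H t z.2.1 z.2.2) :=
        hc.comp (f := fun z : D' × D' × Euc n => ((z.2.1 : PathSp n h T), z.2.2)) (by fun_prop)
      have c3 : Continuous (fun z : D' × D' × Euc n => stopPath t (z.1 : PathSp n h T)) :=
        (hspx t).comp (by fun_prop)
      have c4 : Continuous (fun z : D' × D' × Euc n => stopPath t (z.2.1 : PathSp n h T)) :=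
        (hspx t).comp (by fun_prop)
      exact isClosed_le (by fun_prop) (by fun_prop)
    have hall := hcl.closure_subset_iff.mpr htG
    rw [hSd.closure_eq] at hall
    have htI := hE2s ht2
    have key := hall (Set.mem_univ
      ((⟨x, hDD' x hx⟩, ⟨stopPath t x, ⟨(t, x), ⟨htI, hx⟩, rfl⟩⟩, s) : D' × D' × Euc n))
    simp only [Set.mem_setOf_eq] at key
    rw [hidem t htI x, sub_self, norm_zero, mul_zero] at key
    exact sub_eq_zero.mp (abs_nonpos_iff.mp key)

end
end
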